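/- Suppose that s ≥ 3, k ∈ {3,4}, c is a nonzero integer, and 𝒞*(x₂,…,x_s) is an integral cubic form not of the shape a(b₂x₂+⋯+b_sx_s)³ for rational numbers a, b₂,…,b_s. Let P ≥ 2, Q = P^{3/k}, and let L(P) denote the number of integer solutions of c·x₁^k + 𝒞*(x₂,…,x_s) = c·X₁^k + 𝒞*(X₂,…,X_s) with |x₁| ≤ Q, |X₁| ≤ Q and |x_j| ≤ P, |X_j| ≤ P for 2 ≤ j ≤ s. Then for every ε > 0 there is a constant C (depending on c, 𝒞*, ε) such that L(P) ≤ C·P^{2s-3+ε}·Q^{1/2}. -/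

import Mathlib

/-- The divisor bound `d(n) ≪ n ^ ε`. -/
theorem card_divisors_le_rpow (ε : ℝ) (hε : 0 < ε) :
    ∃ K : ℝ, 0 < K ∧ ∀ n : ℕ, n ≠ 0 → (n.divisors.card : ℝ) ≤ K * (n : ℝ) ^ ε := by
  have hl : 0 < Real.log 2 := Real.log_pos one_lt_two
  set c : ℝ := 1 + 1 / (ε * Real.log 2) with hc
  have hc1 : 1 ≤ c := by rw [hc]; have : 0 < 1 / (ε * Real.log 2) := by positivity
                         linarith
  obtain ⟨T, hT⟩ := exists_nat_gt ((2 : ℝ) ^ (1 / ε))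
  refine ⟨c ^ T, by positivity, fun n hn ↦ ?_⟩
  have key : ∀ p ∈ n.primeFactors, ((n.factorization p + 1 : ℕ) : ℝ) ≤
      (if p < T then c else 1) * ((p : ℝ) ^ n.factorization p) ^ ε := by
    intro p hp
    have hp2 : (2 : ℝ) ≤ p := by exact_mod_cast (Nat.prime_of_mem_primeFactors hp).two_le
    set a := n.factorization p
    have hpa : ((p : ℝ) ^ a) ^ ε = ((p : ℝ) ^ ε) ^ a := by
      rw [← Real.rpow_natCast, ← Real.rpow_natCast, ← Real.rpow_mul (by positivity),
        ← Real.rpow_mul (by positivity), mul_comm]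
    rw [hpa]
    split_ifs with h
    · have h1 : 1 + ε * Real.log 2 ≤ (p : ℝ) ^ ε := by
        calc 1 + ε * Real.log 2 ≤ Real.exp (ε * Real.log 2) := by
              linarith [Real.add_one_le_exp (ε * Real.log 2)]
          _ = (2 : ℝ) ^ ε := by rw [Real.rpow_def_of_pos two_pos, mul_comm]
          _ ≤ _ := Real.rpow_le_rpow (by norm_num) hp2 hε.le
      have h2 : 1 + (a : ℝ) * (ε * Real.log 2) ≤ ((p : ℝ) ^ ε) ^ a :=
        (one_add_mul_le_pow (by nlinarith [mul_pos hε hl]) a).trans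
          (pow_le_pow_left₀ (by positivity) h1 a)
      calc ((a + 1 : ℕ) : ℝ) ≤ c * (1 + (a : ℝ) * (ε * Real.log 2)) := by
            have h3 : (1 / (ε * Real.log 2)) * (ε * Real.log 2) = 1 := by field_simp
            have h4 : 0 < 1 / (ε * Real.log 2) := by positivity
            have h5 : c * (1 + (a : ℝ) * (ε * Real.log 2)) =
                1 + a * (ε * Real.log 2) + 1 / (ε * Real.log 2) + a := by
              rw [hc]; field_simp; ring
            rw [h5]
            have h6 : 0 ≤ (a : ℝ) * (ε * Real.log 2) := by positivity
            push_cast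
            linarith
        _ ≤ _ := by gcongr
    · have hTp : (T : ℝ) ≤ p := by exact_mod_cast not_lt.mp h
      have h1 : 1 + 1 ≤ (p : ℝ) ^ ε := by
        calc (1 + 1 : ℝ) = ((2 : ℝ) ^ (1 / ε)) ^ ε := by
              rw [← Real.rpow_mul (by norm_num)]; field_simp; norm_num
          _ ≤ _ := Real.rpow_le_rpow (by positivity) (by linarith) hε.le
      have h2 : 1 + (a : ℝ) * 1 ≤ ((p : ℝ) ^ ε) ^ a :=
        (one_add_mul_le_pow (by norm_num) a).trans (pow_le_pow_left₀ (by norm_num) h1 a)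
      push_cast
      linarith
  have hprod : (n : ℝ) = ∏ p ∈ n.primeFactors, (p : ℝ) ^ n.factorization p := by
    conv_lhs => rw [← Nat.prod_factorization_pow_eq_self hn]
    simp [Finsupp.prod]
  calc (n.divisors.card : ℝ)
      = ∏ p ∈ n.primeFactors, ((n.factorization p + 1 : ℕ) : ℝ) := by
        rw [Nat.card_divisors hn]; push_cast; rfl
    _ ≤ ∏ p ∈ n.primeFactors, ((if p < T then c else 1) *
          ((p : ℝ) ^ n.factorization p) ^ ε) :=
        Finset.prod_le_prod (fun _ _ ↦ by positivity) key
    _ = (∏ p ∈ n.primeFactors, if p < T then c else 1) * (n : ℝ) ^ ε := by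
        rw [Finset.prod_mul_distrib, Real.finsetProd_rpow _ _ (fun _ _ ↦ by positivity), ← hprod]
    _ ≤ c ^ T * (n : ℝ) ^ ε := by
        gcongr
        rw [Finset.prod_ite, Finset.prod_const, Finset.prod_const_one, mul_one]
        refine pow_le_pow_right₀ hc1 ?_
        calc _ ≤ (Finset.range T).card := Finset.card_le_card fun p hp ↦ by
              simpa using (Finset.mem_filter.mp hp).2
          _ = T := Finset.card_range T

theorem pow_le_of_lacunary (T : Finset ℕ) :
    (∀ v ∈ T, ∀ w ∈ T, v < w → 5 * v < 4 * w) → ∀ w : ℕ, 1 ≤ w → (∀ v ∈ T, 5 * v < 4 * w) →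
      (5 / 4 : ℝ) ^ T.card ≤ 5 / 4 * w := by
  induction T using Finset.induction_on_max with
  | empty =>
    intro _ w hw _
    have : (1 : ℝ) ≤ w := by exact_mod_cast hw
    simp; linarith
  | insert v T hv ih =>
    intro hT w hw hvw
    have hnot : v ∉ T := fun h ↦ lt_irrefl _ (hv v h)
    have hwR : (1 : ℝ) ≤ w := by exact_mod_cast hw
    rw [Finset.card_insert_of_notMem hnot]
    rcases Nat.eq_zero_or_pos v with rfl | hpos
    · have : T = ∅ := Finset.eq_empty_of_forall_notMem fun x hx ↦ by simpa using hv x hx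
      subst this
      simp; linarith
    · have h1 := ih (fun a ha b hb ↦ hT a (Finset.mem_insert_of_mem ha) b
        (Finset.mem_insert_of_mem hb)) v hpos (fun a ha ↦ hT a (Finset.mem_insert_of_mem ha) v
        (Finset.mem_insert_self _ _) (hv a ha))
      have h2 : (5 * v : ℝ) < 4 * w := by exact_mod_cast hvw v (Finset.mem_insert_self _ _)
      rw [pow_succ]
      linarith

theorem le_rpow_of_pow_le {ε : ℝ} (hε : 0 < ε) {c : ℕ} {X : ℝ} (h : (5 / 4 : ℝ) ^ c ≤ X) :
    (c : ℝ) ≤ 1 / (ε * Real.log (5 / 4)) * X ^ ε := by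
  have hl : 0 < Real.log (5 / 4) := Real.log_pos (by norm_num)
  have h1 : ((5 / 4 : ℝ) ^ c) ^ ε ≤ X ^ ε := Real.rpow_le_rpow (by positivity) h hε.le
  have h2 : (c : ℝ) * (ε * Real.log (5 / 4)) ≤ ((5 / 4 : ℝ) ^ c) ^ ε := by
    rw [← Real.rpow_natCast, ← Real.rpow_mul (by norm_num), Real.rpow_def_of_pos (by norm_num)]
    have := Real.add_one_le_exp (Real.log (5 / 4) * (c * ε))
    linarith
  rw [div_mul_eq_mul_div, one_mul, le_div_iff₀ (by positivity)]
  exact h2.trans h1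

/-- Solutions of `u² - D v² = 4` are lacunary. -/
theorem pell_four_gap {D : ℤ} (hD : 1 ≤ D) {u v u' v' : ℤ} (hv : 0 ≤ v) (hu : 0 ≤ u)
    (hu' : 0 ≤ u') (h : u ^ 2 - D * v ^ 2 = 4) (h' : u' ^ 2 - D * v' ^ 2 = 4) (hlt : v < v') :
    5 * v < 4 * v' := by
  rcases hv.eq_or_lt with rfl | hv
  · linarith
  have huv : v < u := by
    by_contra hcon
    nlinarith [mul_self_nonneg v, mul_le_mul_of_nonneg_right hD (mul_self_nonneg v)]
  have huv' : v' < u' := by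
    by_contra hcon
    nlinarith [mul_self_nonneg v', mul_le_mul_of_nonneg_right hD (mul_self_nonneg v')]
  have hprod : (u * v' - u' * v) * (u * v' + u' * v) = 4 * (v' ^ 2 - v ^ 2) := by
    linear_combination v' ^ 2 * h - v ^ 2 * h'
  have hs : 2 * (v * v') < u * v' + u' * v := by nlinarith
  have hvv : 0 < v * v' := by nlinarith
  have hW : 1 ≤ u * v' - u' * v := by
    by_contra hcon
    have : u * v' - u' * v ≤ 0 := by linarith [not_le.mp hcon]
    nlinarith
  have : 2 * (v * v') < 4 * (v' ^ 2 - v ^ 2) := by nlinarith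
  by_contra hcon
  nlinarith

theorem card_pell_four_le (ε : ℝ) (hε : 0 < ε) :
    ∃ K : ℝ, 0 < K ∧ ∀ (Y : ℕ) (D : ℤ), 1 ≤ Y → D ≠ 0 → ∀ S : Finset (ℤ × ℤ),
      (∀ p ∈ S, |p.2| ≤ Y ∧ p.1 ^ 2 - D * p.2 ^ 2 = 4) → (S.card : ℝ) ≤ K * (Y : ℝ) ^ ε := by
  have hl : 0 < Real.log (5 / 4) := Real.log_pos (by norm_num)
  refine ⟨12 + 4 * (1 / (ε * Real.log (5 / 4)) * 4 ^ ε), by positivity,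
    fun Y D hY hD S hS ↦ ?_⟩
  have hYR : (1 : ℝ) ≤ Y := by exact_mod_cast hY
  have hYε : (1 : ℝ) ≤ (Y : ℝ) ^ ε := Real.one_le_rpow hYR hε.le
  set T : Finset ℕ := S.image fun p ↦ p.2.natAbs with hT
  have hfib : S.card ≤ 4 * T.card := by
    refine Finset.card_le_mul_card_image S 4 fun b hb ↦ ?_
    refine (Finset.card_le_card_of_injOn (t := (Finset.univ : Finset (Bool × Bool)))
      (fun p ↦ (decide (0 ≤ p.1), decide (0 ≤ p.2))) (fun _ _ ↦ by simp) ?_).trans (by simp)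
    rintro ⟨u, v⟩ hp ⟨u', v'⟩ hp' heq
    simp only [Finset.coe_filter, Set.mem_ofPred_eq] at hp hp'
    have h1 := (hS _ hp.1).2
    have h2 := (hS _ hp'.1).2
    simp only [Prod.mk.injEq, decide_eq_decide] at heq h1 h2 ⊢
    have hv : v = v' := by omega
    subst hv
    have : u ^ 2 = u' ^ 2 := by linarith
    rcases sq_eq_sq_iff_eq_or_eq_neg.mp this with h | h
    · exact ⟨h, rfl⟩
    · omega
  have hfibR : (S.card : ℝ) ≤ 4 * T.card := by exact_mod_cast hfib
  rcases lt_or_gt_of_ne hD with hneg | hpos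
  · have : T ⊆ Finset.range 3 := by
      intro t ht
      obtain ⟨p, hp, rfl⟩ := Finset.mem_image.mp ht
      have h1 := (hS p hp).2
      have h2 : p.2 ^ 2 ≤ 2 ^ 2 := by nlinarith [sq_nonneg p.1, sq_nonneg p.2]
      have h3 := abs_le_of_sq_le_sq h2 (by norm_num)
      rw [Int.abs_eq_natAbs] at h3
      rw [Finset.mem_range]
      omega
    have h3 : (T.card : ℝ) ≤ 3 := by exact_mod_cast (Finset.card_le_card this)
    have : (0 : ℝ) ≤ 4 * (1 / (ε * Real.log (5 / 4)) * 4 ^ ε) := by positivity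
    nlinarith
  · have hsol : ∀ t ∈ T, ∃ u : ℤ, 0 ≤ u ∧ u ^ 2 - D * (t : ℤ) ^ 2 = 4 ∧ t ≤ Y := by
      intro t ht
      obtain ⟨p, hp, rfl⟩ := Finset.mem_image.mp ht
      refine ⟨|p.1|, abs_nonneg _, ?_, ?_⟩
      · simpa using (hS p hp).2
      · have := (hS p hp).1
        rw [Int.abs_eq_natAbs] at this
        exact_mod_cast this
    have h1 := pow_le_of_lacunary T (fun v hv w hw hvw ↦ by
      obtain ⟨u, hu, h, -⟩ := hsol v hv
      obtain ⟨u', hu', h', -⟩ := hsol w hw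
      exact_mod_cast pell_four_gap hpos (by positivity) hu hu' h h' (by exact_mod_cast hvw))
      (2 * Y) (by omega) (fun v hv ↦ by
        obtain ⟨u, hu, h, h2⟩ := hsol v hv
        omega)
    have h2 := le_rpow_of_pow_le hε (h1.trans (b := 5 / 4 * ((2 * Y : ℕ) : ℝ)) (c := 4 * (Y : ℝ))
      (by push_cast; linarith))
    rw [Real.mul_rpow (by norm_num) (by positivity)] at h2
    nlinarith

theorem dvd_two_of_sq_dvd_four_mul {t m : ℕ} (hm : Squarefree m) (h : t ^ 2 ∣ 4 * m) : t ∣ 2 := by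
  rcases Nat.even_or_odd' t with ⟨r, rfl | rfl⟩
  · have : r * r ∣ m := by
      refine Nat.dvd_of_mul_dvd_mul_left (k := 4) (by norm_num) ?_
      convert h using 1; ring
    rw [Nat.isUnit_iff.mp (hm r this)]
  · have hc : Nat.Coprime ((2 * r + 1) ^ 2) 4 := by
      have : Nat.Coprime (2 * r + 1) 2 := by simp
      exact Nat.Coprime.pow 2 2 this
    have h1 := hc.dvd_of_dvd_mul_left h
    rw [sq] at h1
    rw [Nat.isUnit_iff.mp (hm _ h1)]
    exact one_dvd 2

theorem Int.dvd_of_gcd_mul_eq {N A B e f : ℤ} (he : e ≠ 0) (hef : N = e * f)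
    (hgcd : (Int.gcd N A : ℤ) = e) (h : N ∣ A * B) : f ∣ B := by
  have h1 : N ∣ (Int.gcd (N * B) (A * B) : ℤ) := Int.dvd_coe_gcd (Dvd.intro _ rfl) h
  rw [Int.gcd_mul_right, Nat.cast_mul, hgcd, hef] at h1
  exact Int.dvd_natAbs.mp (Int.dvd_of_mul_dvd_mul_left he h1)

/-- Two primitive solutions of `x² - D z² = N` in the same class relative to a third one. -/
theorem dvd_two_mul_cross {D N X₀ Z₀ X₁ Z₁ X₂ Z₂ : ℤ} (hN : N ≠ 0)
    (hsq : Squarefree (Int.gcd D N))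
    (h0 : X₀ ^ 2 - D * Z₀ ^ 2 = N) (h1 : X₁ ^ 2 - D * Z₁ ^ 2 = N) (h2 : X₂ ^ 2 - D * Z₂ ^ 2 = N)
    (c0 : IsCoprime X₀ Z₀) (c1 : IsCoprime X₁ Z₁)
    (hg : Int.gcd N (X₁ * Z₀ - X₀ * Z₁) = Int.gcd N (X₂ * Z₀ - X₀ * Z₂)) :
    N ∣ 2 * (X₁ * Z₂ - X₂ * Z₁) := by
  have cop : ∀ {X Z : ℤ}, X ^ 2 - D * Z ^ 2 = N → IsCoprime X Z → IsCoprime N Z := by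
    intro X Z h c
    have h3 : IsCoprime (X ^ 2 + Z * (-D * Z)) Z := IsCoprime.add_mul_left_left c.pow_left _
    convert h3 using 1
    linarith
  have n0 := cop h0 c0
  have n1 := cop h1 c1
  set e : ℤ := (Int.gcd N (X₁ * Z₀ - X₀ * Z₁) : ℤ) with he
  have heN : e ∣ N := Int.gcd_dvd_left _ _
  have heA1 : e ∣ X₁ * Z₀ - X₀ * Z₁ := Int.gcd_dvd_right _ _
  have heA2 : e ∣ X₂ * Z₀ - X₀ * Z₂ := by rw [he, hg]; exact Int.gcd_dvd_right _ _
  obtain ⟨f, hf⟩ := heN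
  have he0 : e ≠ 0 := by rintro h; rw [h, zero_mul] at hf; exact hN hf
  have hfB1 : f ∣ X₁ * Z₀ + X₀ * Z₁ := Int.dvd_of_gcd_mul_eq he0 hf he.symm
    ⟨Z₀ ^ 2 - Z₁ ^ 2, by linear_combination Z₀ ^ 2 * h1 - Z₁ ^ 2 * h0⟩
  have hfB2 : f ∣ X₂ * Z₀ + X₀ * Z₂ := Int.dvd_of_gcd_mul_eq he0 hf (by rw [← hg])
    ⟨Z₀ ^ 2 - Z₂ ^ 2, by linear_combination Z₀ ^ 2 * h2 - Z₂ ^ 2 * h0⟩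
  have hef : IsCoprime (e * f) Z₀ := hf ▸ n0
  have heW : e ∣ X₁ * Z₂ - X₂ * Z₁ := by
    refine (hef.of_mul_left_left).dvd_of_dvd_mul_left ?_
    have := (heA1.mul_left Z₂).sub (heA2.mul_left Z₁)
    convert this using 1; ring
  have hfW : f ∣ X₁ * Z₂ - X₂ * Z₁ := by
    refine (hef.of_mul_left_right).dvd_of_dvd_mul_left ?_
    have := (hfB1.mul_left Z₂).sub (hfB2.mul_left Z₁)
    convert this using 1; ring
  set t := Int.gcd e f with ht
  have hte : (t : ℤ) ∣ e := Int.gcd_dvd_left _ _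
  have htf : (t : ℤ) ∣ f := Int.gcd_dvd_right _ _
  have htN : (t : ℤ) ^ 2 ∣ N := by rw [hf, sq]; exact mul_dvd_mul hte htf
  have htX : (t : ℤ) ∣ 2 * X₀ := by
    have hc : IsCoprime (t : ℤ) Z₁ :=
      IsCoprime.of_isCoprime_of_dvd_left n1 (hte.trans (Dvd.intro _ hf.symm))
    refine hc.dvd_of_dvd_mul_right ?_
    have := (htf.trans hfB1).sub (hte.trans heA1)
    convert this using 1; ring
  have htD : (t : ℤ) ^ 2 ∣ 4 * D := by
    have hc : IsCoprime ((t : ℤ) ^ 2) (Z₀ ^ 2) :=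
      (IsCoprime.of_isCoprime_of_dvd_left n0 htN).pow_right
    refine hc.dvd_of_dvd_mul_right ?_
    have := (pow_dvd_pow_of_dvd htX 2).sub (htN.mul_left 4)
    convert this using 1
    linear_combination (-4 : ℤ) * h0
  have ht2 : t ∣ 2 := by
    refine dvd_two_of_sq_dvd_four_mul hsq ?_
    have := Int.dvd_coe_gcd htD (htN.mul_left 4)
    rw [Int.gcd_mul_left] at this
    exact_mod_cast this
  have hNt : N ∣ t * (X₁ * Z₂ - X₂ * Z₁) := by
    have h3 : (Int.lcm e f : ℤ) ∣ X₁ * Z₂ - X₂ * Z₁ := Int.coe_lcm_dvd heW hfW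
    have h4 : N ∣ t * Int.lcm e f := by
      have h5 : ((Int.gcd e f * Int.lcm e f : ℕ) : ℤ) = (e.natAbs * f.natAbs : ℕ) := by
        rw [Int.gcd_mul_lcm]
      push_cast at h5
      rw [ht, h5, hf, ← abs_mul]
      exact (dvd_abs _ _).mpr dvd_rfl
    exact h4.trans (mul_dvd_mul_left _ h3)
  exact hNt.trans (mul_dvd_mul_right (by exact_mod_cast ht2) _)

theorem card_primitive_le (ε : ℝ) (hε : 0 < ε) :
    ∃ K : ℝ, 0 < K ∧ ∀ (Y : ℕ) (D N : ℤ), 1 ≤ Y → D ≠ 0 → N ≠ 0 → Squarefree (Int.gcd D N) →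
      ∀ S : Finset (ℤ × ℤ), (∀ p ∈ S, |p.1| ≤ Y ∧ |p.2| ≤ Y ∧ IsCoprime p.1 p.2 ∧
        p.1 ^ 2 - D * p.2 ^ 2 = N) → (S.card : ℝ) ≤ N.natAbs.divisors.card * (K * (Y : ℝ) ^ ε) := by
  obtain ⟨K, hK, hpell⟩ := card_pell_four_le (ε / 2) (by positivity)
  refine ⟨K * 4 ^ (ε / 2), by positivity, fun Y D N hY hD hN hsq S hS ↦ ?_⟩
  have hKY : K * 4 ^ (ε / 2) * (Y : ℝ) ^ ε = K * ((4 * Y ^ 2 : ℕ) : ℝ) ^ (ε / 2) := by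
    push_cast
    rw [Real.mul_rpow (by norm_num) (by positivity), ← Real.rpow_natCast,
      ← Real.rpow_mul (by positivity), mul_assoc]
    congr 3
    push_cast; ring
  rw [hKY]
  rcases S.eq_empty_or_nonempty with rfl | ⟨p₀, hp₀⟩
  · simp; positivity
  obtain ⟨-, -, c0, h0⟩ := hS p₀ hp₀
  set φ : ℤ × ℤ → ℕ := fun p ↦ Int.gcd N (p.1 * p₀.2 - p₀.1 * p.2) with hφ
  have himg : S.image φ ⊆ N.natAbs.divisors := by
    intro e he
    obtain ⟨p, -, rfl⟩ := Finset.mem_image.mp he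
    rw [Nat.mem_divisors]
    exact ⟨Nat.gcd_dvd_left _ _, by simpa using hN⟩
  have hfib : ∀ e ∈ S.image φ, ((S.filter fun p ↦ φ p = e).card : ℝ) ≤
      K * ((4 * Y ^ 2 : ℕ) : ℝ) ^ (ε / 2) := by
    intro e he
    obtain ⟨p₁, hp₁, rfl⟩ := Finset.mem_image.mp he
    obtain ⟨b1, b1', c1, h1⟩ := hS p₁ hp₁
    have hdiv : ∀ p ∈ S.filter fun p ↦ φ p = φ p₁, ∃ q : ℤ × ℤ,
        |q.2| ≤ ((4 * Y ^ 2 : ℕ) : ℤ) ∧ q.1 ^ 2 - D * q.2 ^ 2 = 4 ∧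
        N * q.1 = 2 * (p₁.1 * p.1 - D * p₁.2 * p.2) ∧ N * q.2 = 2 * (p₁.1 * p.2 - p.1 * p₁.2) := by
      intro p hp
      obtain ⟨hpS, hpe⟩ := Finset.mem_filter.mp hp
      obtain ⟨b2, b2', c2, h2⟩ := hS p hpS
      obtain ⟨v, hv⟩ := dvd_two_mul_cross hN hsq h0 h1 h2 c0 c1 hpe.symm
      have hnorm : (2 * (p₁.1 * p.1 - D * p₁.2 * p.2)) ^ 2 = N ^ 2 * (4 + D * v ^ 2) := by
        linear_combination (4 : ℤ) * N * h1 + 4 * (p₁.1 ^ 2 - D * p₁.2 ^ 2) * h2 +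
          D * (2 * (p₁.1 * p.2 - p.1 * p₁.2) + N * v) * hv
      obtain ⟨u, hu⟩ : N ∣ 2 * (p₁.1 * p.1 - D * p₁.2 * p.2) :=
        (Int.pow_dvd_pow_iff two_ne_zero).mp (Dvd.intro _ hnorm.symm)
      refine ⟨(u, v), ?_, ?_, hu.symm, hv.symm⟩
      · have hv1 : |v| ≤ |N * v| := by
          rw [abs_mul]
          exact le_mul_of_one_le_left (abs_nonneg _) (Int.one_le_abs hN)
        have hv2 : |2 * (p₁.1 * p.2 - p.1 * p₁.2)| ≤ 4 * (Y : ℤ) ^ 2 := by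
          have e1 : |p₁.1 * p.2| ≤ (Y : ℤ) * Y := by
            rw [abs_mul]; exact mul_le_mul b1 b2' (abs_nonneg _) (by positivity)
          have e2 : |p.1 * p₁.2| ≤ (Y : ℤ) * Y := by
            rw [abs_mul]; exact mul_le_mul b2 b1' (abs_nonneg _) (by positivity)
          rw [abs_mul, abs_two]
          have := abs_sub (p₁.1 * p.2) (p.1 * p₁.2)
          nlinarith
        push_cast
        rw [← hv] at hv1
        exact hv1.trans hv2
      · have hN2 : N ^ 2 ≠ 0 := pow_ne_zero 2 hN
        apply mul_left_cancel₀ hN2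
        rw [hu] at hnorm
        linear_combination hnorm
    choose! ψ hψ using hdiv
    have hinj : Set.InjOn ψ (S.filter fun p ↦ φ p = φ p₁ : Finset _) := by
      intro p hp q hq hpq
      obtain ⟨-, -, e1, e2⟩ := hψ p hp
      obtain ⟨-, -, e3, e4⟩ := hψ q hq
      rw [hpq] at e1 e2
      have A : p₁.1 * p.1 - D * p₁.2 * p.2 = p₁.1 * q.1 - D * p₁.2 * q.2 := by linarith
      have B : p₁.1 * p.2 - p.1 * p₁.2 = p₁.1 * q.2 - q.1 * p₁.2 := by linarith
      have a1 : N * p.1 = N * q.1 := by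
        linear_combination p₁.1 * A + D * p₁.2 * B - (p.1 - q.1) * h1
      have a2 : N * p.2 = N * q.2 := by
        linear_combination p₁.2 * A + p₁.1 * B - (p.2 - q.2) * h1
      exact Prod.ext (mul_left_cancel₀ hN a1) (mul_left_cancel₀ hN a2)
    rw [← Finset.card_image_of_injOn hinj]
    refine hpell _ D (by nlinarith) hD _ fun q hq ↦ ?_
    obtain ⟨p, hp, rfl⟩ := Finset.mem_image.mp hq
    exact ⟨(hψ p hp).1, (hψ p hp).2.1⟩
  calc (S.card : ℝ) = ∑ e ∈ S.image φ, ((S.filter fun p ↦ φ p = e).card : ℝ) := by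
        rw [Finset.card_eq_sum_card_image φ S]; push_cast; rfl
    _ ≤ ∑ e ∈ S.image φ, K * ((4 * Y ^ 2 : ℕ) : ℝ) ^ (ε / 2) := Finset.sum_le_sum hfib
    _ ≤ _ := by
      rw [Finset.sum_const, nsmul_eq_mul]
      gcongr

/-- `x² - D z² = N` has `O(Y ^ ε)` integer solutions of size at most `Y`, uniformly in `D ≠ 0` and
`0 < |N| ≤ Y`. -/
theorem card_sq_sub_mul_sq_le (ε : ℝ) (hε : 0 < ε) :
    ∃ K : ℝ, 0 < K ∧ ∀ (Y : ℕ) (D N : ℤ), 1 ≤ Y → D ≠ 0 → N ≠ 0 → |N| ≤ Y →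
      ∀ S : Finset (ℤ × ℤ), (∀ p ∈ S, |p.1| ≤ Y ∧ |p.2| ≤ Y ∧ p.1 ^ 2 - D * p.2 ^ 2 = N) →
        (S.card : ℝ) ≤ K * (Y : ℝ) ^ ε := by
  obtain ⟨K₁, hK₁, hprim⟩ := card_primitive_le (ε / 3) (by positivity)
  obtain ⟨K₂, hK₂, hdiv⟩ := card_divisors_le_rpow (ε / 3) (by positivity)
  refine ⟨K₂ * (K₂ * K₁), by positivity, fun Y D N hY hD hN hNY S hS ↦ ?_⟩
  have hY0 : (0 : ℝ) < Y := by exact_mod_cast hY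
  have hdN : (N.natAbs.divisors.card : ℝ) ≤ K₂ * (Y : ℝ) ^ (ε / 3) := by
    refine (hdiv _ (by simpa using hN)).trans ?_
    have : (N.natAbs : ℝ) ≤ Y := by
      rw [Int.abs_eq_natAbs] at hNY
      exact_mod_cast hNY
    gcongr
  set φ : ℤ × ℤ → ℕ := fun p ↦ Int.gcd p.1 p.2 with hφ
  have hφN : ∀ p ∈ S, ((φ p : ℤ) ^ 2 ∣ N) := by
    intro p hp
    rw [← (hS p hp).2.2]
    exact (pow_dvd_pow_of_dvd (Int.gcd_dvd_left _ _) 2).sub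
      ((pow_dvd_pow_of_dvd (Int.gcd_dvd_right _ _) 2).mul_left D)
  have himg : S.image φ ⊆ N.natAbs.divisors := by
    intro e he
    obtain ⟨p, hp, rfl⟩ := Finset.mem_image.mp he
    rw [Nat.mem_divisors]
    exact ⟨Int.natCast_dvd.mp ((dvd_pow_self _ two_ne_zero).trans (hφN p hp)), by simpa using hN⟩
  have hfib : ∀ g ∈ S.image φ, ((S.filter fun p ↦ φ p = g).card : ℝ) ≤
      K₂ * (Y : ℝ) ^ (ε / 3) * (K₁ * (Y : ℝ) ^ (ε / 3)) := by
    intro g hg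
    obtain ⟨p₁, hp₁, hp₁g⟩ := Finset.mem_image.mp hg
    obtain ⟨N₁, hN₁⟩ : (g : ℤ) ^ 2 ∣ N := hp₁g ▸ hφN p₁ hp₁
    have hg0 : (g : ℤ) ≠ 0 := by rintro h; rw [h] at hN₁; simp at hN₁; exact hN hN₁
    have hN₁0 : N₁ ≠ 0 := by rintro rfl; simp at hN₁; exact hN hN₁
    obtain ⟨m, b, hbm, hm⟩ := Nat.sq_mul_squarefree (Int.gcd D N₁)
    have hb2 : (b : ℤ) ^ 2 ∣ (Int.gcd D N₁ : ℤ) := ⟨m, by rw [← hbm]; push_cast; ring⟩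
    obtain ⟨D₂, hD₂⟩ := hb2.trans (Int.gcd_dvd_left D N₁)
    obtain ⟨N₂, hN₂⟩ := hb2.trans (Int.gcd_dvd_right D N₁)
    have hb0 : (b : ℤ) ≠ 0 := by rintro h; rw [h] at hN₂; simp at hN₂; exact hN₁0 hN₂
    have hD₂0 : D₂ ≠ 0 := by rintro rfl; simp at hD₂; exact hD hD₂
    have hN₂0 : N₂ ≠ 0 := by rintro rfl; simp at hN₂; exact hN₁0 hN₂
    have hsq : Squarefree (Int.gcd D₂ N₂) := by
      have h1 : b ^ 2 * Int.gcd D₂ N₂ = b ^ 2 * m := by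
        rw [hbm]
        conv_rhs => rw [hD₂, hN₂]
        rw [Int.gcd_mul_left]
        simp [Int.natAbs_pow]
      have hb0' : b ^ 2 ≠ 0 := by
        have : b ≠ 0 := by exact_mod_cast hb0
        positivity
      rwa [Nat.eq_of_mul_eq_mul_left (Nat.pos_of_ne_zero hb0') h1]
    have hred : ∀ p ∈ S.filter fun p ↦ φ p = g, ∃ q : ℤ × ℤ, p.1 = g * (b * q.1) ∧ p.2 = g * q.2 ∧
        IsCoprime q.1 q.2 ∧ q.1 ^ 2 - D₂ * q.2 ^ 2 = N₂ := by
      intro p hp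
      obtain ⟨hpS, rfl⟩ := Finset.mem_filter.mp hp
      have hpos : 0 < Int.gcd p.1 p.2 := Nat.pos_of_ne_zero (by exact_mod_cast hg0)
      obtain ⟨x, z, hc, hx, hz⟩ := Int.exists_gcd_one hpos
      have heq : x ^ 2 - D * z ^ 2 = N₁ := by
        have h1 := (hS p hpS).2.2
        rw [hN₁] at h1
        apply mul_left_cancel₀ (pow_ne_zero 2 hg0)
        have hx' : p.1 = x * (φ p : ℤ) := hx
        have hz' : p.2 = z * (φ p : ℤ) := hz
        rw [hx', hz'] at h1
        linear_combination h1
      obtain ⟨y, rfl⟩ : (b : ℤ) ∣ x := by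
        rw [← Int.pow_dvd_pow_iff two_ne_zero]
        exact ⟨N₂ + D₂ * z ^ 2, by linear_combination heq + hN₂ + z ^ 2 * hD₂⟩
      refine ⟨(y, z), ?_, ?_, ?_, ?_⟩
      · rw [mul_comm]; exact hx
      · rw [mul_comm]; exact hz
      · exact (Int.isCoprime_iff_gcd_eq_one.mpr hc).of_mul_left_right
      · apply mul_left_cancel₀ (pow_ne_zero 2 hb0)
        linear_combination heq + hN₂ + z ^ 2 * hD₂
    choose! ψ hψ using hred
    have hinj : Set.InjOn ψ (S.filter fun p ↦ φ p = g : Finset _) := by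
      intro p hp q hq hpq
      obtain ⟨e1, e2, -⟩ := hψ p hp
      obtain ⟨e3, e4, -⟩ := hψ q hq
      rw [hpq] at e1 e2
      exact Prod.ext (e1.trans e3.symm) (e2.trans e4.symm)
    rw [← Finset.card_image_of_injOn hinj]
    refine (hprim Y D₂ N₂ hY hD₂0 hN₂0 hsq _ fun q hq ↦ ?_).trans ?_
    · obtain ⟨p, hp, rfl⟩ := Finset.mem_image.mp hq
      obtain ⟨e1, e2, e3, e4⟩ := hψ p hp
      obtain ⟨b1, b2, -⟩ := hS p (Finset.mem_filter.mp hp).1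
      refine ⟨le_trans ?_ b1, le_trans ?_ b2, e3, e4⟩
      · rw [e1, abs_mul, abs_mul, ← mul_assoc, ← abs_mul]
        exact le_mul_of_one_le_left (abs_nonneg _) (Int.one_le_abs (mul_ne_zero hg0 hb0))
      · rw [e2, abs_mul]
        exact le_mul_of_one_le_left (abs_nonneg _) (Int.one_le_abs hg0)
    · have : (N₂.natAbs.divisors.card : ℝ) ≤ N.natAbs.divisors.card := by
        have hd : N₂.natAbs ∣ N.natAbs := Int.natAbs_dvd_natAbs.mpr
          ⟨(g : ℤ) ^ 2 * b ^ 2, by rw [hN₁, hN₂]; ring⟩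
        exact_mod_cast Finset.card_le_card (Nat.divisors_subset_of_dvd (by simpa using hN) hd)
      gcongr
      exact this.trans hdN
  calc (S.card : ℝ) = ∑ e ∈ S.image φ, ((S.filter fun p ↦ φ p = e).card : ℝ) := by
        rw [Finset.card_eq_sum_card_image φ S]; push_cast; rfl
    _ ≤ ∑ e ∈ S.image φ, K₂ * (Y : ℝ) ^ (ε / 3) * (K₁ * (Y : ℝ) ^ (ε / 3)) :=
        Finset.sum_le_sum hfib
    _ ≤ (K₂ * (Y : ℝ) ^ (ε / 3)) * (K₂ * (Y : ℝ) ^ (ε / 3) * (K₁ * (Y : ℝ) ^ (ε / 3))) := by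
      rw [Finset.sum_const, nsmul_eq_mul]
      gcongr
      refine le_trans ?_ hdN
      exact_mod_cast Finset.card_le_card himg
    _ = K₂ * (K₂ * K₁) * (Y : ℝ) ^ ε := by
      have : (Y : ℝ) ^ ε = (Y : ℝ) ^ (ε / 3) * (Y : ℝ) ^ (ε / 3) * (Y : ℝ) ^ (ε / 3) := by
        rw [← Real.rpow_add hY0, ← Real.rpow_add hY0]; congr 1; ring
      rw [this]; ring

/-- Integer points on a non-degenerate conic. -/
theorem card_conic_le (ε : ℝ) (hε : 0 < ε) :
    ∃ K : ℝ, 0 < K ∧ ∀ (Y : ℕ) (a b c d e f : ℤ), 1 ≤ Y → |a| ≤ Y → |b| ≤ Y → |c| ≤ Y → |d| ≤ Y →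
      |e| ≤ Y → |f| ≤ Y → b ^ 2 - a * c ≠ 0 →
      (b ^ 2 - a * c) * f + a * e ^ 2 - 2 * b * d * e + c * d ^ 2 ≠ 0 →
      ∀ S : Finset (ℤ × ℤ), (∀ p ∈ S, |p.1| ≤ Y ∧ |p.2| ≤ Y ∧
        a * p.1 ^ 2 + 2 * b * p.1 * p.2 + c * p.2 ^ 2 + 2 * d * p.1 + 2 * e * p.2 + f = 0) →
        (S.card : ℝ) ≤ K * (Y : ℝ) ^ ε := by
  obtain ⟨K, hK, hmain⟩ := card_sq_sub_mul_sq_le (ε / 4) (by positivity)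
  have hmain' : ∀ (Y : ℕ) (a b c d e f : ℤ), 1 ≤ Y → |a| ≤ Y → |b| ≤ Y → |c| ≤ Y → |d| ≤ Y →
      |e| ≤ Y → |f| ≤ Y → b ^ 2 - a * c ≠ 0 → a ≠ 0 →
      (b ^ 2 - a * c) * f + a * e ^ 2 - 2 * b * d * e + c * d ^ 2 ≠ 0 →
      ∀ S : Finset (ℤ × ℤ), (∀ p ∈ S, |p.1| ≤ Y ∧ |p.2| ≤ Y ∧
        a * p.1 ^ 2 + 2 * b * p.1 * p.2 + c * p.2 ^ 2 + 2 * d * p.1 + 2 * e * p.2 + f = 0) →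
        (S.card : ℝ) ≤ K * 6 ^ (ε / 4) * (Y : ℝ) ^ ε := by
    intro Y a b c d e f hY ha hb hc hd he hf hD ha0 hΔ S hS
    have hY1 : (1 : ℤ) ≤ Y := by exact_mod_cast hY
    set D := b ^ 2 - a * c with hDdef
    set ψ : ℤ × ℤ → ℤ × ℤ := fun p ↦ (D * p.2 - (a * e - b * d), a * p.1 + b * p.2 + d) with hψ
    have hinj : Function.Injective ψ := by
      rintro ⟨x, y⟩ ⟨x', y'⟩ h
      simp only [hψ, Prod.mk.injEq] at h
      obtain ⟨h1, h2⟩ := h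
      have hy : y = y' := mul_left_cancel₀ hD (by linarith)
      subst hy
      have hx : x = x' := mul_left_cancel₀ ha0 (by linarith)
      rw [hx]
    have hKY : K * 6 ^ (ε / 4) * (Y : ℝ) ^ ε = K * ((6 * Y ^ 4 : ℕ) : ℝ) ^ (ε / 4) := by
      push_cast
      rw [Real.mul_rpow (by norm_num) (by positivity), ← Real.rpow_natCast,
        ← Real.rpow_mul (by positivity), mul_assoc]
      congr 3
      push_cast; ring
    rw [hKY, ← Finset.card_image_of_injective S hinj]
    have pr : ∀ {u v : ℤ} {k l : ℤ}, |u| ≤ k → |v| ≤ l → |u * v| ≤ k * l := by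
      intro u v k l h1 h2
      rw [abs_mul]; exact mul_le_mul h1 h2 (abs_nonneg _) ((abs_nonneg _).trans h1)
    have hY2 : (Y : ℤ) ≤ Y * Y := by nlinarith
    have hY3 : (Y : ℤ) * Y ≤ Y * Y * Y := by nlinarith
    have hY4 : (Y : ℤ) * Y * Y ≤ Y * Y * Y * Y := by nlinarith
    have hDb : |D| ≤ 2 * (Y * Y) := by
      have := abs_sub (b * b) (a * c)
      rw [hDdef, sq]; linarith [pr hb hb, pr ha hc]
    refine hmain (6 * Y ^ 4) D (a * (D * f + a * e ^ 2 - 2 * b * d * e + c * d ^ 2)) ?_ hD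
      (mul_ne_zero ha0 hΔ) ?_ _ ?_
    · nlinarith [Nat.one_le_pow 4 Y hY]
    · have h1 : |D * f + a * e ^ 2 - 2 * b * d * e + c * d ^ 2| ≤ 6 * ((Y : ℤ) * Y * Y) := by
        have e1 := pr hDb hf
        have e2 := pr (pr ha he) he
        have e3 := pr (pr (pr (abs_two (α := ℤ)).le hb) hd) he
        have e4 := pr (pr hc hd) hd
        have t1 := abs_add_le (D * f + a * e * e - 2 * b * d * e) (c * d * d)
        have t2 := abs_sub (D * f + a * e * e) (2 * b * d * e)
        have t3 := abs_add_le (D * f) (a * e * e)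
        have : D * f + a * e ^ 2 - 2 * b * d * e + c * d ^ 2 =
          D * f + a * e * e - 2 * b * d * e + c * d * d := by ring
        rw [this]
        linarith
      have h2 := pr ha h1
      push_cast
      have hpow : 6 * (Y : ℤ) ^ 4 = Y * (6 * (Y * Y * Y)) := by ring
      rw [hpow]
      exact h2
    · intro q hq
      obtain ⟨⟨x, y⟩, hp, rfl⟩ := Finset.mem_image.mp hq
      obtain ⟨b1, b2, h⟩ := hS _ hp
      simp only at b1 b2 h
      refine ⟨?_, ?_, ?_⟩
      · have t1 := abs_sub (D * y) (a * e - b * d)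
        have t2 := abs_sub (a * e) (b * d)
        have := pr hDb b2
        have := pr ha he
        have := pr hb hd
        simp only [hψ]
        push_cast
        have hpow : (Y : ℤ) ^ 4 = Y * Y * Y * Y := by ring
        have : (0 : ℤ) ≤ Y * Y * Y * Y := by positivity
        rw [hpow]
        linarith
      · have t1 := abs_add_le (a * x + b * y) d
        have t2 := abs_add_le (a * x) (b * y)
        have := pr ha b1
        have := pr hb b2
        simp only [hψ]
        push_cast
        have hpow : (Y : ℤ) ^ 4 = Y * Y * Y * Y := by ring
        have : (0 : ℤ) ≤ Y * Y * Y * Y := by positivity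
        rw [hpow]
        linarith
      · simp only [hψ]
        linear_combination (-D * a) * h
  refine ⟨K * 6 ^ (ε / 4) * 4 ^ ε, by positivity, fun Y a b c d e f hY ha hb hc hd he hf hD hΔ S hS ↦ ?_⟩
  have hY1 : (1 : ℤ) ≤ Y := by exact_mod_cast hY
  have hKY : K * 6 ^ (ε / 4) * 4 ^ ε * (Y : ℝ) ^ ε = K * 6 ^ (ε / 4) * ((4 * Y : ℕ) : ℝ) ^ ε := by
    push_cast
    rw [Real.mul_rpow (by norm_num) (by positivity)]; ring
  rw [hKY]
  have big : ∀ {u : ℤ}, |u| ≤ Y → |u| ≤ ((4 * Y : ℕ) : ℤ) := fun h ↦ by push_cast; linarith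
  by_cases ha0 : a = 0
  · subst ha0
    by_cases hc0 : c = 0
    · subst hc0
      have hb0 : b ≠ 0 := by rintro rfl; simp at hD
      have hinj : Function.Injective fun p : ℤ × ℤ ↦ (p.1, p.2 - p.1) := by
        rintro ⟨x, y⟩ ⟨x', y'⟩ h
        simp only [Prod.mk.injEq] at h ⊢
        omega
      rw [← Finset.card_image_of_injective S hinj]
      refine hmain' (4 * Y) (2 * b) b 0 (d + e) e f (by omega) ?_ (big hb) (by simp) ?_ (big he)
        (big hf) (by simpa using hb0) (by simpa using hb0) ?_ _ ?_
      · rw [abs_mul, abs_two]; push_cast; linarith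
      · have := abs_add_le d e; push_cast; linarith
      · intro h; apply hΔ; linear_combination h
      · intro q hq
        obtain ⟨⟨x, y⟩, hp, rfl⟩ := Finset.mem_image.mp hq
        obtain ⟨b1, b2, h⟩ := hS _ hp
        simp only at b1 b2 h ⊢
        refine ⟨big b1, ?_, by linear_combination h⟩
        have := abs_sub y x
        push_cast; linarith
    · rw [← Finset.card_image_of_injective S Prod.swap_injective]
      refine hmain' (4 * Y) c b 0 e d f (by omega) (big hc) (big hb) (by simp) (big he) (big hd)
        (big hf) (by simpa using hD) hc0 ?_ _ ?_
      · intro h; apply hΔ; linear_combination h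
      · intro q hq
        obtain ⟨⟨x, y⟩, hp, rfl⟩ := Finset.mem_image.mp hq
        obtain ⟨b1, b2, h⟩ := hS _ hp
        simp only [Prod.swap] at b1 b2 h ⊢
        exact ⟨big b2, big b1, by linear_combination h⟩
  · exact hmain' (4 * Y) a b c d e f (by omega) (big ha) (big hb) (big hc) (big hd) (big he)
      (big hf) hD ha0 hΔ S fun p hp ↦ ⟨big (hS p hp).1, big (hS p hp).2.1, (hS p hp).2.2⟩

/-- The integer points of sup norm at most `B`. -/
noncomputable def box (ι : Type*) [Fintype ι] [DecidableEq ι] (B : ℕ) : Finset (ι → ℤ) :=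
  Fintype.piFinset fun _ ↦ Finset.Icc (-(B : ℤ)) B

section Box

variable {ι : Type*} [Fintype ι] [DecidableEq ι]

theorem mem_box {B : ℕ} {x : ι → ℤ} : x ∈ box ι B ↔ ∀ i, |x i| ≤ B := by
  simp [box, abs_le]

theorem card_Icc_neg (B : ℕ) : (Finset.Icc (-(B : ℤ)) B).card = 2 * B + 1 := by
  rw [Int.card_Icc]; omega

theorem card_box (B : ℕ) : (box ι B).card = (2 * B + 1) ^ Fintype.card ι := by
  simp only [box, Fintype.card_piFinset, card_Icc_neg, Finset.prod_const, Finset.card_univ]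

theorem card_zeros_mul_le {p : MvPolynomial ι ℤ} (hp : p ≠ 0) (B : ℕ) :
    ((box ι B).filter fun x ↦ MvPolynomial.eval x p = 0).card * (2 * B + 1) ≤
      p.totalDegree * (2 * B + 1) ^ Fintype.card ι := by
  set e := Fintype.equivFin ι
  have hq : MvPolynomial.rename e p ≠ 0 := by
    simpa using (MvPolynomial.rename_injective e e.injective).ne hp
  have h := MvPolynomial.schwartz_zippel_totalDegree hq (Finset.Icc (-(B : ℤ)) B)
  rw [card_Icc_neg,
    div_le_div_iff₀ (by positivity) (by positivity)] at h
  have hcard : ((box ι B).filter fun x ↦ MvPolynomial.eval x p = 0).card ≤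
      ((Fintype.piFinset fun _ : Fin (Fintype.card ι) ↦ Finset.Icc (-(B : ℤ)) B).filter
        fun f ↦ MvPolynomial.eval f (MvPolynomial.rename e p) = 0).card := by
    refine Finset.card_le_card_of_injOn (fun x ↦ x ∘ e.symm) ?_ ?_
    · intro x hx
      simp only [box, Finset.coe_filter, Fintype.mem_piFinset, Set.mem_ofPred_eq] at hx ⊢
      refine ⟨fun k ↦ hx.1 _, ?_⟩
      rw [MvPolynomial.eval_rename, Function.comp_assoc, e.symm_comp_self]
      exact hx.2
    · intro x _ y _ hxy
      exact e.symm.surjective.injective_comp_right hxy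
  refine (Nat.mul_le_mul_right _ hcard).trans
    (le_trans ?_ (Nat.mul_le_mul_right _ (MvPolynomial.totalDegree_rename_le e p)))
  exact_mod_cast h

end Box

theorem card_conic_trivial_le {a b c : ℤ} (d e f : ℤ) (h : b ^ 2 - a * c ≠ 0) (B : ℕ)
    (S : Finset (ℤ × ℤ)) (hS : ∀ p ∈ S, |p.1| ≤ B ∧ |p.2| ≤ B ∧
      a * p.1 ^ 2 + 2 * b * p.1 * p.2 + c * p.2 ^ 2 + 2 * d * p.1 + 2 * e * p.2 + f = 0) :
    S.card ≤ 2 * (2 * B + 1) := by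
  set q : MvPolynomial (Fin 2) ℤ := .C a * .X 0 ^ 2 + .C (2 * b) * .X 0 * .X 1 + .C c * .X 1 ^ 2 +
    .C (2 * d) * .X 0 + .C (2 * e) * .X 1 + .C f with hq
  have heval : ∀ x : Fin 2 → ℤ, MvPolynomial.eval x q = a * x 0 ^ 2 + 2 * b * x 0 * x 1 +
      c * x 1 ^ 2 + 2 * d * x 0 + 2 * e * x 1 + f := by
    intro x; simp [hq]
  have hq0 : q ≠ 0 := by
    intro h0
    have hz : ∀ x y : ℤ, a * x ^ 2 + 2 * b * x * y + c * y ^ 2 + 2 * d * x + 2 * e * y + f = 0 := by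
      intro x y
      have := heval ![x, y]
      rw [h0] at this
      simpa using this.symm
    have h00 := hz 0 0
    have h10 := hz 1 0
    have h10' := hz (-1) 0
    have h01 := hz 0 1
    have h01' := hz 0 (-1)
    have h11 := hz 1 1
    have ha : a = 0 := by linarith
    have hc : c = 0 := by linarith
    have hb : b = 0 := by linarith
    apply h; rw [ha, hb]; ring
  have hdeg : q.totalDegree ≤ 2 := by
    have t1 : ∀ (u : ℤ) (k : Fin 2), (MvPolynomial.C u * MvPolynomial.X k ^ 2 :
        MvPolynomial (Fin 2) ℤ).totalDegree ≤ 2 := fun u k ↦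
      (MvPolynomial.totalDegree_mul _ _).trans (by
        rw [MvPolynomial.totalDegree_C, MvPolynomial.totalDegree_X_pow])
    have t2 : ∀ (u : ℤ) (k : Fin 2), (MvPolynomial.C u * MvPolynomial.X k :
        MvPolynomial (Fin 2) ℤ).totalDegree ≤ 1 := fun u k ↦
      (MvPolynomial.totalDegree_mul _ _).trans (by
        rw [MvPolynomial.totalDegree_C, MvPolynomial.totalDegree_X])
    have t3 : (MvPolynomial.C (2 * b) * MvPolynomial.X 0 * MvPolynomial.X 1 :
        MvPolynomial (Fin 2) ℤ).totalDegree ≤ 2 :=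
      (MvPolynomial.totalDegree_mul _ _).trans (by
        rw [MvPolynomial.totalDegree_X]; linarith [t2 (2 * b) 0])
    have add : ∀ {u v : MvPolynomial (Fin 2) ℤ}, u.totalDegree ≤ 2 → v.totalDegree ≤ 2 →
        (u + v).totalDegree ≤ 2 := fun hu hv ↦
      (MvPolynomial.totalDegree_add _ _).trans (max_le hu hv)
    exact add (add (add (add (add (t1 _ _) t3) (t1 _ _)) ((t2 _ _).trans one_le_two))
      ((t2 _ _).trans one_le_two))
      ((MvPolynomial.totalDegree_C _).le.trans (Nat.zero_le _))
  have h1 := card_zeros_mul_le hq0 B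
  have h2 : S.card ≤ ((box (Fin 2) B).filter fun x ↦ MvPolynomial.eval x q = 0).card := by
    refine Finset.card_le_card_of_injOn (fun p ↦ ![p.1, p.2]) ?_ ?_
    · intro p hp
      obtain ⟨b1, b2, h3⟩ := hS p hp
      simp only [Finset.coe_filter, Set.mem_ofPred_eq, mem_box, heval]
      exact ⟨fun i ↦ by fin_cases i <;> simpa, by simpa using h3⟩
    · intro p _ p' _ hpp
      have e0 := congrFun hpp 0
      have e1 := congrFun hpp 1
      exact Prod.ext (by simpa using e0) (by simpa using e1)
  rw [Fintype.card_fin] at h1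
  have h3 : S.card * (2 * B + 1) ≤ 2 * (2 * B + 1) * (2 * B + 1) := by
    calc _ ≤ _ := Nat.mul_le_mul_right _ h2
      _ ≤ _ := h1
      _ ≤ 2 * (2 * B + 1) ^ 2 := Nat.mul_le_mul_right _ hdeg
      _ = _ := by ring
  exact Nat.le_of_mul_le_mul_right h3 (by omega)

theorem sum_eq_add_add_sum_subtype {ι : Type*} [Fintype ι] [DecidableEq ι] {i j : ι} (hij : i ≠ j)
    (g : ι → ℤ) : ∑ k, g k = g i + g j + ∑ k : {k // k ≠ i ∧ k ≠ j}, g k := by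
  rw [← Finset.add_sum_erase Finset.univ g (Finset.mem_univ i),
    ← Finset.add_sum_erase _ g (show j ∈ Finset.univ.erase i by simpa using hij.symm), add_assoc]
  congr 2
  exact Finset.sum_subtype _ (by simp [and_comm]) g

theorem card_conic_family_le (κ : Type*) [Fintype κ] [DecidableEq κ] (ε : ℝ) (hε : 0 < ε) :
    ∃ K : ℝ, 0 < K ∧ ∀ (Y B : ℕ) (a b c : ℤ) (d e f : MvPolynomial κ ℤ), 1 ≤ Y → B ≤ Y →
      |a| ≤ Y → |b| ≤ Y → |c| ≤ Y →
      (∀ r ∈ box κ B, |MvPolynomial.eval r d| ≤ Y ∧ |MvPolynomial.eval r e| ≤ Y ∧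
        |MvPolynomial.eval r f| ≤ Y) →
      d.totalDegree ≤ 1 → e.totalDegree ≤ 1 → f.totalDegree ≤ 2 →
      b ^ 2 - a * c ≠ 0 →
      .C (b ^ 2 - a * c) * f + .C a * e ^ 2 - .C (2 * b) * (d * e) + .C c * d ^ 2 ≠ 0 →
      ∀ S : Finset ((ℤ × ℤ) × (κ → ℤ)), (∀ p ∈ S, |p.1.1| ≤ B ∧ |p.1.2| ≤ B ∧ p.2 ∈ box κ B ∧
        a * p.1.1 ^ 2 + 2 * b * p.1.1 * p.1.2 + c * p.1.2 ^ 2 +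
          2 * MvPolynomial.eval p.2 d * p.1.1 + 2 * MvPolynomial.eval p.2 e * p.1.2 +
          MvPolynomial.eval p.2 f = 0) →
        (S.card : ℝ) ≤ K * (Y : ℝ) ^ ε * (2 * B + 1) ^ Fintype.card κ := by
  obtain ⟨K, hK, hconic⟩ := card_conic_le ε hε
  refine ⟨K + 4, by positivity, fun Y B a b c d e f hY hBY ha hb hc hbd hd he hf hD hΔ S hS ↦ ?_⟩
  set Δ : MvPolynomial κ ℤ :=
    .C (b ^ 2 - a * c) * f + .C a * e ^ 2 - .C (2 * b) * (d * e) + .C c * d ^ 2 with hΔdef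
  have hYε : (1 : ℝ) ≤ (Y : ℝ) ^ ε := Real.one_le_rpow (by exact_mod_cast hY) hε.le
  have hdeg : Δ.totalDegree ≤ 2 := by
    have hC : ∀ (u : ℤ) {v : MvPolynomial κ ℤ}, v.totalDegree ≤ 2 →
        (MvPolynomial.C u * v).totalDegree ≤ 2 := fun u v hv ↦
      (MvPolynomial.totalDegree_mul _ _).trans (by rw [MvPolynomial.totalDegree_C]; omega)
    have hm : ∀ {u v : MvPolynomial κ ℤ}, u.totalDegree ≤ 1 → v.totalDegree ≤ 1 →
        (u * v).totalDegree ≤ 2 := fun hu hv ↦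
      (MvPolynomial.totalDegree_mul _ _).trans (by omega)
    have add : ∀ {u v : MvPolynomial κ ℤ}, u.totalDegree ≤ 2 → v.totalDegree ≤ 2 →
        (u + v).totalDegree ≤ 2 := fun hu hv ↦
      (MvPolynomial.totalDegree_add _ _).trans (max_le hu hv)
    have sub : ∀ {u v : MvPolynomial κ ℤ}, u.totalDegree ≤ 2 → v.totalDegree ≤ 2 →
        (u - v).totalDegree ≤ 2 := fun hu hv ↦
      (MvPolynomial.totalDegree_sub _ _).trans (max_le hu hv)
    rw [hΔdef, sq e, sq d]
    exact add (sub (add (hC _ hf) (hC _ (hm he he))) (hC _ (hm hd he))) (hC _ (hm hd hd))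
  have hfib : ∀ r ∈ box κ B, ((S.filter fun p ↦ p.2 = r).card : ℝ) ≤
      K * (Y : ℝ) ^ ε + if MvPolynomial.eval r Δ = 0 then 2 * (2 * (B : ℝ) + 1) else 0 := by
    intro r hr
    obtain ⟨b1, b2, b3⟩ := hbd r hr
    have hinj : Set.InjOn Prod.fst
        (↑(S.filter fun p ↦ p.2 = r) : Set ((ℤ × ℤ) × (κ → ℤ))) := by
      intro p hp q hq hpq
      simp only [Finset.coe_filter, Set.mem_ofPred_eq] at hp hq
      exact Prod.ext hpq (hp.2.trans hq.2.symm)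
    rw [← Finset.card_image_of_injOn hinj]
    have hmem : ∀ q ∈ (S.filter fun p ↦ p.2 = r).image Prod.fst, |q.1| ≤ B ∧ |q.2| ≤ B ∧
        a * q.1 ^ 2 + 2 * b * q.1 * q.2 + c * q.2 ^ 2 + 2 * MvPolynomial.eval r d * q.1 +
          2 * MvPolynomial.eval r e * q.2 + MvPolynomial.eval r f = 0 := by
      intro q hq
      obtain ⟨p, hp, rfl⟩ := Finset.mem_image.mp hq
      obtain ⟨hpS, rfl⟩ := Finset.mem_filter.mp hp
      obtain ⟨h1, h2, -, h3⟩ := hS p hpS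
      exact ⟨h1, h2, h3⟩
    split_ifs with h0
    · have h1 := (Nat.cast_le (α := ℝ)).mpr (card_conic_trivial_le _ _ _ hD B _ hmem)
      push_cast at h1
      have : 0 ≤ K * (Y : ℝ) ^ ε := by positivity
      linarith
    · rw [add_zero]
      refine hconic Y a b c _ _ _ hY ha hb hc b1 b2 b3 hD ?_ _ fun q hq ↦ ?_
      · intro h1
        apply h0
        rw [hΔdef]
        simp only [map_add, map_sub, map_mul, map_pow, MvPolynomial.eval_C]
        linear_combination h1
      · obtain ⟨h1, h2, h3⟩ := hmem q hq
        have : (B : ℤ) ≤ Y := by exact_mod_cast hBY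
        exact ⟨h1.trans this, h2.trans this, h3⟩
  have hz : ((((box κ B).filter fun r ↦ MvPolynomial.eval r Δ = 0).card : ℕ) : ℝ) * (2 * B + 1) ≤
      2 * (2 * B + 1) ^ Fintype.card κ := by
    exact_mod_cast (card_zeros_mul_le hΔ B).trans (Nat.mul_le_mul_right _ hdeg)
  calc (S.card : ℝ) = ∑ r ∈ box κ B, ((S.filter fun p ↦ p.2 = r).card : ℝ) := by
        rw [Finset.card_eq_sum_card_fiberwise (f := Prod.snd) (t := box κ B)
          (fun p hp ↦ (hS p hp).2.2.1)]
        push_cast; rfl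
    _ ≤ ∑ r ∈ box κ B, (K * (Y : ℝ) ^ ε +
          if MvPolynomial.eval r Δ = 0 then 2 * (2 * (B : ℝ) + 1) else 0) := Finset.sum_le_sum hfib
    _ = (2 * B + 1) ^ Fintype.card κ * (K * (Y : ℝ) ^ ε) +
        2 * ((((box κ B).filter fun r ↦ MvPolynomial.eval r Δ = 0).card : ℕ) * (2 * B + 1)) := by
      rw [Finset.sum_add_distrib, Finset.sum_const, card_box, nsmul_eq_mul, ← Finset.sum_filter,
        Finset.sum_const, nsmul_eq_mul]
      push_cast; ring
    _ ≤ (2 * B + 1) ^ Fintype.card κ * (K * (Y : ℝ) ^ ε) +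
        2 * (2 * (2 * B + 1) ^ Fintype.card κ) := by gcongr
    _ ≤ _ := by
      have : (0 : ℝ) ≤ (2 * B + 1) ^ Fintype.card κ := by positivity
      nlinarith

/-- Integer points on a quadric `Q = N`, `N ≠ 0`, when `Q` has a non-zero principal minor of
order two. -/
theorem card_quadric_le (ι : Type*) [Fintype ι] [DecidableEq ι] (i j : ι) (hij : i ≠ j)
    (ε : ℝ) (hε : 0 < ε) :
    ∃ K : ℝ, 0 < K ∧ ∀ (Y B : ℕ) (A : ι → ι → ℤ) (N : ℤ), 1 ≤ Y → B ≤ Y → (∀ k l, |A k l| ≤ Y) →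
      (∀ k l, A k l = A l k) → |N| ≤ Y → N ≠ 0 → A i j ^ 2 - A i i * A j j ≠ 0 →
      (((box ι B).filter fun x ↦ ∑ k, ∑ l, A k l * x k * x l = N).card : ℝ) * (2 * B + 1) ^ 2 ≤
        K * (Y : ℝ) ^ ε * (2 * B + 1) ^ Fintype.card ι := by
  set κ := {k // k ≠ i ∧ k ≠ j}
  obtain ⟨K, hK, hfam⟩ := card_conic_family_le κ (ε / 3) (by positivity)
  set n := Fintype.card κ with hn
  refine ⟨K * (n ^ 2 + n + 1 : ℕ) ^ (ε / 3), by positivity,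
    fun Y B A N hY hBY hA hsymm hNY hN hD ↦ ?_⟩
  have hYZ : (1 : ℤ) ≤ Y := by exact_mod_cast hY
  have hcard : Fintype.card ι = n + 2 := by
    have := sum_eq_add_add_sum_subtype hij fun _ ↦ 1
    simp only [Finset.sum_const, Finset.card_univ, nsmul_eq_mul, mul_one] at this
    have h2 : (Fintype.card ι : ℤ) = n + 2 := by rw [this, hn]; ring
    exact_mod_cast h2
  set d : MvPolynomial κ ℤ := ∑ k : κ, .C (A i k) * .X k with hd
  set e : MvPolynomial κ ℤ := ∑ k : κ, .C (A j k) * .X k with he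
  set f : MvPolynomial κ ℤ := ∑ k : κ, ∑ l : κ, .C (A k l) * (.X k * .X l) - .C N with hf
  have hlin : ∀ t : ι, (∑ k : κ, .C (A t k) * .X k : MvPolynomial κ ℤ).totalDegree ≤ 1 := fun t ↦
    MvPolynomial.totalDegree_finsetSum_le fun k _ ↦ (MvPolynomial.totalDegree_mul _ _).trans (by
      rw [MvPolynomial.totalDegree_C, MvPolynomial.totalDegree_X])
  have hfdeg : f.totalDegree ≤ 2 := by
    refine (MvPolynomial.totalDegree_sub _ _).trans 
      (max_le ?_ ((MvPolynomial.totalDegree_C _).le.trans (Nat.zero_le _)))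
    refine MvPolynomial.totalDegree_finsetSum_le fun k _ ↦
      MvPolynomial.totalDegree_finsetSum_le fun l _ ↦
        (MvPolynomial.totalDegree_mul _ _).trans ?_
    have := MvPolynomial.totalDegree_mul (MvPolynomial.X k) (MvPolynomial.X l : MvPolynomial κ ℤ)
    rw [MvPolynomial.totalDegree_X, MvPolynomial.totalDegree_X] at this
    rw [MvPolynomial.totalDegree_C]
    omega
  have evlin : ∀ (t : ι) (r : κ → ℤ),
      MvPolynomial.eval r (∑ k : κ, .C (A t k) * .X k) = ∑ k : κ, A t k * r k := by
    intro t r; simp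
  have evf : ∀ r : κ → ℤ, MvPolynomial.eval r f = ∑ k : κ, ∑ l : κ, A k l * (r k * r l) - N := by
    intro r; simp [hf]
  have hBZ : (B : ℤ) ≤ Y := by exact_mod_cast hBY
  have hY13 : (Y : ℤ) ≤ Y ^ 3 := by
    calc (Y : ℤ) = Y ^ 1 := (pow_one _).symm
      _ ≤ _ := pow_le_pow_right₀ hYZ (by norm_num)
  have hY23 : (Y : ℤ) ^ 2 ≤ Y ^ 3 := pow_le_pow_right₀ hYZ (by norm_num)
  have hY3 : (0 : ℤ) ≤ Y ^ 3 := by positivity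
  have hYY : ((((n ^ 2 + n + 1) * Y ^ 3 : ℕ) : ℤ)) = n ^ 2 * Y ^ 3 + n * Y ^ 3 + Y ^ 3 := by
    push_cast; ring
  have hn1 : (0 : ℤ) ≤ n * Y ^ 3 := by positivity
  have hn2 : (0 : ℤ) ≤ n ^ 2 * Y ^ 3 := by positivity
  have bdlin : ∀ (t : ι), ∀ r ∈ box κ B, |∑ k : κ, A t k * r k| ≤ ((n ^ 2 + n + 1) * Y ^ 3 : ℕ) := by
    intro t r hr
    rw [mem_box] at hr
    have : |∑ k : κ, A t k * r k| ≤ n * (Y : ℤ) ^ 2 := by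
      calc _ ≤ ∑ k : κ, |A t k * r k| := Finset.abs_sum_le_sum_abs _ _
        _ ≤ ∑ k : κ, (Y : ℤ) ^ 2 := Finset.sum_le_sum fun k _ ↦ by
          rw [abs_mul, sq]
          exact mul_le_mul (hA _ _) ((hr k).trans hBZ) (abs_nonneg _) (by positivity)
        _ = _ := by simp [hn]
    have h2 : n * (Y : ℤ) ^ 2 ≤ n * Y ^ 3 := by gcongr
    rw [hYY]; linarith
  have big : ∀ {u : ℤ}, |u| ≤ Y → |u| ≤ ((n ^ 2 + n + 1) * Y ^ 3 : ℕ) := by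
    intro u hu
    rw [hYY]; linarith
  have hmain := hfam ((n ^ 2 + n + 1) * Y ^ 3) B (A i i) (A i j) (A j j) d e f
    (by have := Nat.one_le_pow 3 Y hY; nlinarith)
    (by
      have : (B : ℤ) ≤ ((n ^ 2 + n + 1) * Y ^ 3 : ℕ) := by rw [hYY]; linarith
      exact_mod_cast this)
    (big (hA _ _)) (big (hA _ _)) (big (hA _ _))
    (by
      intro r hr
      rw [hd, he, evlin, evlin, evf]
      refine ⟨bdlin _ r hr, bdlin _ r hr, ?_⟩
      rw [mem_box] at hr
      have h1 : |∑ k : κ, ∑ l : κ, A k l * (r k * r l)| ≤ n ^ 2 * (Y : ℤ) ^ 3 := by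
        calc _ ≤ ∑ k : κ, |∑ l : κ, A k l * (r k * r l)| := Finset.abs_sum_le_sum_abs _ _
          _ ≤ ∑ k : κ, ∑ l : κ, |A k l * (r k * r l)| :=
            Finset.sum_le_sum fun k _ ↦ Finset.abs_sum_le_sum_abs _ _
          _ ≤ ∑ k : κ, ∑ l : κ, (Y : ℤ) ^ 3 := Finset.sum_le_sum fun k _ ↦
            Finset.sum_le_sum fun l _ ↦ by
              rw [abs_mul, abs_mul, pow_succ', sq]
              exact mul_le_mul (hA _ _) (mul_le_mul ((hr k).trans hBZ) ((hr l).trans hBZ)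
                (abs_nonneg _) (by positivity)) (by positivity) (by positivity)
          _ = _ := by simp [hn]; ring
      have h2 := abs_sub (∑ k : κ, ∑ l : κ, A k l * (r k * r l)) N
      rw [hYY]; linarith)
    (hlin i) (hlin j) hfdeg hD
    (by
      intro h0
      have h1 := congrArg (MvPolynomial.eval 0) h0
      simp only [map_add, map_sub, map_mul, map_pow, MvPolynomial.eval_C, hd, he, evlin, evf] at h1
      simp only [Pi.zero_apply, mul_zero, Finset.sum_const_zero, map_zero] at h1
      have h2 : (A i j ^ 2 - A i i * A j j) * N = 0 := by linear_combination -h1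
      exact (mul_ne_zero hD hN) h2)
    (((box ι B).filter fun x ↦ ∑ k, ∑ l, A k l * x k * x l = N).image
      fun x ↦ ((x i, x j), fun k : κ ↦ x k))
    (by
      intro p hp
      obtain ⟨x, hx, rfl⟩ := Finset.mem_image.mp hp
      obtain ⟨hxB, hxN⟩ := Finset.mem_filter.mp hx
      rw [mem_box] at hxB
      refine ⟨hxB i, hxB j, mem_box.mpr fun k ↦ hxB k, ?_⟩
      simp only [hd, he, evlin, evf]
      rw [sum_eq_add_add_sum_subtype hij] at hxN
      simp only [sum_eq_add_add_sum_subtype hij (fun l ↦ _)] at hxN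
      rw [Finset.sum_add_distrib, Finset.sum_add_distrib] at hxN
      have s1 : ∑ k : κ, A k i * x k * x i = (∑ k : κ, A i k * x k) * x i := by
        rw [Finset.sum_mul]; exact Finset.sum_congr rfl fun k _ ↦ by rw [hsymm]
      have s2 : ∑ k : κ, A k j * x k * x j = (∑ k : κ, A j k * x k) * x j := by
        rw [Finset.sum_mul]; exact Finset.sum_congr rfl fun k _ ↦ by rw [hsymm]
      have s3 : ∑ k : κ, A i k * x i * x k = (∑ k : κ, A i k * x k) * x i := by
        rw [Finset.sum_mul]; exact Finset.sum_congr rfl fun k _ ↦ by ring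
      have s4 : ∑ k : κ, A j k * x j * x k = (∑ k : κ, A j k * x k) * x j := by
        rw [Finset.sum_mul]; exact Finset.sum_congr rfl fun k _ ↦ by ring
      have s5 : ∑ k : κ, ∑ l : κ, A k l * x k * x l = ∑ k : κ, ∑ l : κ, A k l * (x k * x l) :=
        Finset.sum_congr rfl fun k _ ↦ Finset.sum_congr rfl fun l _ ↦ by ring
      rw [s1, s2, s3, s4, s5, hsymm j i] at hxN
      linear_combination hxN)
  rw [Finset.card_image_of_injective] at hmain
  · rw [hcard, pow_add, ← mul_assoc]
    refine mul_le_mul_of_nonneg_right (hmain.trans (le_of_eq ?_)) (by positivity)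
    push_cast
    rw [Real.mul_rpow (by positivity) (by positivity), ← Real.rpow_natCast _ 3,
      ← Real.rpow_mul (by positivity)]
    have : ((3 : ℕ) : ℝ) * (ε / 3) = ε := by push_cast; ring
    rw [this]; ring
  · intro x y hxy
    simp only [Prod.mk.injEq] at hxy
    funext k
    by_cases hki : k = i
    · rw [hki]; exact hxy.1.1
    by_cases hkj : k = j
    · rw [hkj]; exact hxy.1.2
    exact congrFun hxy.2 ⟨k, hki, hkj⟩

section Collisions

variable {α α' β γ : Type*} [DecidableEq β] [DecidableEq γ]

theorem card_pairs_eq_sum (S : Finset α) (S' : Finset α') (f : α → β) (g : α' → β)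
    {T : Finset β} (hT : ∀ s ∈ S, f s ∈ T) :
    ((S ×ˢ S').filter fun p ↦ f p.1 = g p.2).card =
      ∑ b ∈ T, (S.filter fun s ↦ f s = b).card * (S'.filter fun s ↦ g s = b).card := by
  rw [Finset.card_eq_sum_card_fiberwise (f := fun p : α × α' ↦ f p.1) (t := T)
    (fun p hp ↦ hT _ (Finset.mem_product.mp (Finset.mem_filter.mp hp).1).1)]
  refine Finset.sum_congr rfl fun b _ ↦ ?_
  rw [← Finset.card_product]
  congr 1
  ext p
  simp only [Finset.mem_filter, Finset.mem_product]
  constructor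
  · rintro ⟨⟨⟨h1, h2⟩, h3⟩, rfl⟩
    exact ⟨⟨h1, rfl⟩, h2, h3.symm⟩
  · rintro ⟨⟨h1, h2⟩, h3, h4⟩
    exact ⟨⟨⟨h1, h3⟩, h2.trans h4.symm⟩, h2⟩

theorem sq_card_pairs_le (S : Finset α) (S' : Finset α') (f : α → β) (g : α' → β) :
    ((S ×ˢ S').filter fun p ↦ f p.1 = g p.2).card ^ 2 ≤
      ((S ×ˢ S).filter fun p ↦ f p.1 = f p.2).card *
        ((S' ×ˢ S').filter fun p ↦ g p.1 = g p.2).card := by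
  have h1 : ∀ s ∈ S, f s ∈ S.image f ∪ S'.image g := fun s hs ↦
    Finset.mem_union_left _ (Finset.mem_image_of_mem _ hs)
  have h2 : ∀ s ∈ S', g s ∈ S.image f ∪ S'.image g := fun s hs ↦
    Finset.mem_union_right _ (Finset.mem_image_of_mem _ hs)
  rw [card_pairs_eq_sum S S' f g h1, card_pairs_eq_sum S S f f h1, card_pairs_eq_sum S' S' g g h2]
  simp only [← sq]
  exact Finset.sum_mul_sq_le_sq_mul_sq _ _ _

theorem card_collisions_le (S : Finset α) (f : α → β) (φ : α → γ) :
    ((S ×ˢ S).filter fun p ↦ f p.1 = f p.2).card ≤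
      (S.image φ).card * ((S ×ˢ S).filter fun p ↦ f p.1 = f p.2 ∧ φ p.1 = φ p.2).card := by
  have h1 : ∀ s ∈ S, f s ∈ S.image f := fun s hs ↦ Finset.mem_image_of_mem _ hs
  have h2 : ∀ s ∈ S, (f s, φ s) ∈ S.image f ×ˢ S.image φ := fun s hs ↦
    Finset.mem_product.mpr ⟨Finset.mem_image_of_mem _ hs, Finset.mem_image_of_mem _ hs⟩
  have h3 := card_pairs_eq_sum S S (fun s ↦ (f s, φ s)) (fun s ↦ (f s, φ s)) h2
  simp only [Prod.mk.injEq, ← sq] at h3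
  rw [h3, card_pairs_eq_sum S S f f h1, Finset.sum_product, Finset.mul_sum]
  refine Finset.sum_le_sum fun b _ ↦ ?_
  rw [← sq]
  have h4 : (S.filter fun s ↦ f s = b).card =
      ∑ c ∈ S.image φ, (S.filter fun s ↦ f s = b ∧ φ s = c).card := by
    rw [Finset.card_eq_sum_card_fiberwise (f := φ) (t := S.image φ)
      (fun s hs ↦ Finset.mem_image_of_mem _ (Finset.mem_filter.mp hs).1)]
    simp only [Finset.filter_filter]
  simp only [h4, Prod.mk.injEq]
  exact_mod_cast sq_sum_le_card_mul_sum_sq (α := ℕ) (s := S.image φ)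
    (f := fun c ↦ (S.filter fun s ↦ f s = b ∧ φ s = c).card)

end Collisions

section Tensor

variable {ι : Type*} [Fintype ι]

/-- The matrix obtained from a three-tensor by contracting its last index with a vector. -/
def contract (t : ι → ι → ι → ℤ) (a : ι → ℤ) (k l : ι) : ℤ := ∑ m, t k l m * a m

/-- The bilinear form of a matrix evaluated on the diagonal. -/
def quad (A : ι → ι → ℤ) (x : ι → ℤ) : ℤ := ∑ k, ∑ l, A k l * x k * x l

/-- The cubic form of a three-tensor. -/
def cubic (t : ι → ι → ι → ℤ) (x : ι → ℤ) : ℤ := quad (contract t x) x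

theorem contract_add (t : ι → ι → ι → ℤ) (a b : ι → ℤ) (k l : ι) :
    contract t (a + b) k l = contract t a k l + contract t b k l := by
  simp [contract, mul_add, Finset.sum_add_distrib]

theorem contract_sub (t : ι → ι → ι → ℤ) (a b : ι → ℤ) (k l : ι) :
    contract t (a - b) k l = contract t a k l - contract t b k l := by
  simp [contract, mul_sub, Finset.sum_sub_distrib]

theorem contract_smul (t : ι → ι → ι → ℤ) (c : ℤ) (a : ι → ℤ) (k l : ι) :
    contract t (c • a) k l = c * contract t a k l := by
  simp only [contract, Finset.mul_sum, Pi.smul_apply, smul_eq_mul]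
  exact Finset.sum_congr rfl fun _ _ ↦ by ring

theorem contract_single [DecidableEq ι] (t : ι → ι → ι → ℤ) (m k l : ι) :
    contract t (Pi.single m 1) k l = t k l m := by
  simp [contract, Pi.single_apply]

/-- A symmetric three-tensor all of whose contractions have vanishing principal minors of order
two is a multiple of the cube of a vector. -/
theorem eq_mul_cube_of_minors [DecidableEq ι] {t : ι → ι → ι → ℤ}
    (h12 : ∀ i j k, t i j k = t j i k)
    (h23 : ∀ i j k, t i j k = t i k j)
    (H : ∀ i j, i ≠ j → ∀ a : ι → ℤ,
      contract t a i j ^ 2 - contract t a i i * contract t a j j = 0) :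
    ∃ (a : ℚ) (b : ι → ℚ), ∀ i j k, (t i j k : ℚ) = a * b i * b j * b k := by
  have H' : ∀ i j (a : ι → ℤ), contract t a i j ^ 2 = contract t a i i * contract t a j j := by
    intro i j a
    by_cases hij : i = j
    · rw [hij, sq]
    · linarith [H i j hij a]
  by_cases h0 : ∀ i, t i i i = 0
  · refine ⟨0, 0, fun i j k ↦ ?_⟩
    have h1 : ∀ i j, t i i j = 0 := by
      intro i j
      have := H' i j (Pi.single i 1)
      simp only [contract_single, h0 i, zero_mul] at this
      rw [h23]
      exact pow_eq_zero_iff two_ne_zero |>.mp this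
    have h2 := H' i j (Pi.single k 1)
    simp only [contract_single, h1, zero_mul] at h2
    rw [pow_eq_zero_iff two_ne_zero |>.mp h2]
    simp
  · push Not at h0
    obtain ⟨o, ho⟩ := h0
    have hw0 : ∀ v : ι → ℤ, contract t (t o o o • v - contract t v o o • Pi.single o 1) o o = 0 := by
      intro v
      rw [contract_sub, contract_smul, contract_smul, contract_single]; ring
    have h1 : ∀ (j) (v : ι → ℤ), t o o o * contract t v o j = contract t v o o * t o j o := by
      intro j v
      have h2 := H' o j (t o o o • v - contract t v o o • Pi.single o 1)
      rw [hw0, zero_mul] at h2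
      have h3 := pow_eq_zero_iff two_ne_zero |>.mp h2
      rw [contract_sub, contract_smul, contract_smul, contract_single] at h3
      linarith
    have h2' : ∀ (j) (v : ι → ℤ), contract t v o o ≠ 0 →
        t o o o ^ 2 * contract t v j j = contract t v o o * t o j o ^ 2 := by
      intro j v hv
      apply mul_left_cancel₀ hv
      linear_combination (-t o o o ^ 2) * H' o j v +
        (t o o o * contract t v o j + contract t v o o * t o j o) * h1 j v
    have h2 : ∀ (j) (v : ι → ℤ),
        t o o o ^ 2 * contract t v j j = contract t v o o * t o j o ^ 2 := by
      intro j v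
      by_cases hv : contract t v o o = 0
      · have e1 := h2' j (v + Pi.single o 1)
          (by rw [contract_add, hv, contract_single, zero_add]; exact ho)
        have e2 := h2' j (Pi.single o 1) (by rw [contract_single]; exact ho)
        rw [contract_add, contract_add, hv, contract_single, contract_single] at e1
        rw [contract_single, contract_single] at e2
        rw [hv]
        linarith
      · exact h2' j v hv
    have h3 : ∀ (j k) (v : ι → ℤ), t o o o * contract t v j k = contract t v o o * t j k o := by
      intro j k v
      have e1 := h2 j (t o o o • v - contract t v o o • Pi.single o 1)
      rw [hw0, zero_mul] at e1
      have e2 := (mul_eq_zero_iff_left (pow_ne_zero 2 ho)).mp e1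
      have e3 := H' j k (t o o o • v - contract t v o o • Pi.single o 1)
      rw [e2, zero_mul] at e3
      have e4 := pow_eq_zero_iff two_ne_zero |>.mp e3
      rw [contract_sub, contract_smul, contract_smul, contract_single] at e4
      linarith
    refine ⟨1 / (t o o o : ℚ) ^ 2, fun j ↦ t o o j, fun i j k ↦ ?_⟩
    have hoQ : (t o o o : ℚ) ≠ 0 := by exact_mod_cast ho
    have e1 := h3 i j (Pi.single k 1)
    have e2 := h1 i (Pi.single j 1)
    simp only [contract_single] at e1 e2
    have e3 : t i j o = t o i j := by rw [h23, h12]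
    have e4 : t o i o = t o o i := h23 _ _ _
    rw [e3] at e1
    rw [e4] at e2
    have e5 : t o o o ^ 2 * t i j k = t o o i * t o o j * t o o k := by
      linear_combination t o o o * e1 + t o o k * e2
    have e6 : (t o o o : ℚ) ^ 2 * t i j k = t o o i * t o o j * t o o k := by exact_mod_cast e5
    field_simp
    linarith

end Tensor

section Polarisation

variable {ι : Type*} [Fintype ι]

theorem contract_symm {t : ι → ι → ι → ℤ} (h12 : ∀ i j k, t i j k = t j i k) (a : ι → ℤ)
    (k l : ι) : contract t a k l = contract t a l k :=
  Finset.sum_congr rfl fun m _ ↦ by rw [h12]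

theorem quad_smul (A : ι → ι → ℤ) (c : ℤ) (x : ι → ℤ) : quad A (c • x) = c ^ 2 * quad A x := by
  simp only [quad, Finset.mul_sum, Pi.smul_apply, smul_eq_mul]
  exact Finset.sum_congr rfl fun _ _ ↦ Finset.sum_congr rfl fun _ _ ↦ by ring

theorem quad_mul_left (A : ι → ι → ℤ) (c : ℤ) (x : ι → ℤ) :
    quad (fun k l ↦ c * A k l) x = c * quad A x := by
  simp only [quad, Finset.mul_sum]
  exact Finset.sum_congr rfl fun _ _ ↦ Finset.sum_congr rfl fun _ _ ↦ by ring

theorem quad_contract_smul (t : ι → ι → ι → ℤ) (c : ℤ) (a x : ι → ℤ) :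
    quad (contract t (c • a)) x = c * quad (contract t a) x := by
  rw [← quad_mul_left]
  congr 1
  funext k l
  exact contract_smul t c a k l

theorem cubic_smul (t : ι → ι → ι → ℤ) (c : ℤ) (x : ι → ℤ) :
    cubic t (c • x) = c ^ 3 * cubic t x := by
  rw [cubic, quad_contract_smul, quad_smul, cubic]; ring

theorem quad_add {A : ι → ι → ℤ} (hA : ∀ k l, A k l = A l k) (x y : ι → ℤ) :
    quad A (x + y) = quad A x + 2 * (∑ k, ∑ l, A k l * x k * y l) + quad A y := by
  have h : ∑ k, ∑ l, A k l * y k * x l = ∑ k, ∑ l, A k l * x k * y l := by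
    rw [Finset.sum_comm]
    exact Finset.sum_congr rfl fun k _ ↦ Finset.sum_congr rfl fun l _ ↦ by rw [hA l k]; ring
  have h2 : quad A (x + y) = quad A x + (∑ k, ∑ l, A k l * x k * y l) +
      (∑ k, ∑ l, A k l * y k * x l) + quad A y := by
    simp only [quad, ← Finset.sum_add_distrib, Pi.add_apply]
    exact Finset.sum_congr rfl fun _ _ ↦ Finset.sum_congr rfl fun _ _ ↦ by ring
  rw [h2, h]; ring

theorem sum_contract_mul {t : ι → ι → ι → ℤ} (h23 : ∀ i j k, t i j k = t i k j) (a b : ι → ℤ) :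
    ∑ k, ∑ l, contract t a k l * a k * b l = quad (contract t b) a := by
  simp only [quad, contract, Finset.sum_mul]
  refine Finset.sum_congr rfl fun k _ ↦ ?_
  rw [Finset.sum_comm]
  exact Finset.sum_congr rfl fun l _ ↦ Finset.sum_congr rfl fun m _ ↦ by rw [h23]; ring

theorem cubic_add {t : ι → ι → ι → ℤ} (h12 : ∀ i j k, t i j k = t j i k)
    (h23 : ∀ i j k, t i j k = t i k j) (a b : ι → ℤ) :
    cubic t (a + b) = cubic t a + 3 * quad (contract t b) a + 3 * quad (contract t a) b +
      cubic t b := by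
  have h1 : ∀ x, quad (contract t (a + b)) x = quad (contract t a) x + quad (contract t b) x := by
    intro x
    simp only [quad, contract_add, ← Finset.sum_add_distrib]
    exact Finset.sum_congr rfl fun _ _ ↦ Finset.sum_congr rfl fun _ _ ↦ by ring
  have h2 := sum_contract_mul h23 b a
  have h3 : ∑ k, ∑ l, contract t b k l * a k * b l = quad (contract t a) b := by
    rw [← h2, Finset.sum_comm]
    exact Finset.sum_congr rfl fun _ _ ↦ Finset.sum_congr rfl fun _ _ ↦ by
      rw [contract_symm h12]; ring
  rw [cubic, h1, quad_add (contract_symm h12 a), quad_add (contract_symm h12 b),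
    sum_contract_mul h23, h3, cubic, cubic]
  ring

theorem four_mul_cubic_sub {t : ι → ι → ι → ℤ} (h12 : ∀ i j k, t i j k = t j i k)
    (h23 : ∀ i j k, t i j k = t i k j) (x y : ι → ℤ) :
    4 * (cubic t x - cubic t y) = 3 * quad (contract t (x - y)) (x + y) + cubic t (x - y) := by
  have e1 : (x - y) + (x + y) = (2 : ℤ) • x := by
    funext i; simp; ring
  have e2 : (-1 : ℤ) • (x - y) + (x + y) = (2 : ℤ) • y := by
    funext i; simp; ring
  have h1 := cubic_add h12 h23 (x - y) (x + y)
  have h2 := cubic_add h12 h23 ((-1 : ℤ) • (x - y)) (x + y)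
  rw [e1, cubic_smul] at h1
  rw [e2, cubic_smul, cubic_smul, quad_smul, quad_contract_smul] at h2
  linarith

theorem mul_cubic_sub {t : ι → ι → ι → ℤ} (h12 : ∀ i j k, t i j k = t j i k)
    (h23 : ∀ i j k, t i j k = t i k j) {x y e : ι → ℤ} {g h : ℤ} (hxy : g • (x - y) = h • e) :
    4 * g ^ 3 * (cubic t x - cubic t y) =
      h * (3 * g ^ 2 * quad (contract t e) (x + y) + h ^ 2 * cubic t e) := by
  have h1 := four_mul_cubic_sub h12 h23 x y
  have h2 := quad_contract_smul t g (x - y) (x + y)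
  have h3 := cubic_smul t g (x - y)
  rw [hxy, quad_contract_smul] at h2
  rw [hxy, cubic_smul] at h3
  linear_combination g ^ 3 * h1 - 3 * g ^ 2 * h2 - h3

theorem eq_zero_of_quad_eq_zero [DecidableEq ι] {A : ι → ι → ℤ} (hA : ∀ k l, A k l = A l k)
    (h : ∀ x, quad A x = 0) (k l : ι) : A k l = 0 := by
  have h1 := quad_add hA (Pi.single k 1) (Pi.single l 1)
  rw [h, h, h] at h1
  simp [Pi.single_apply] at h1
  exact h1

end Polarisation

section Counting

variable {ι : Type*} [Fintype ι] [DecidableEq ι] {m : ℕ}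

theorem le_of_mul_le_mul_pow {R c d : ℝ} {m : ℕ} (hR : 0 < R) (j : ℕ) {n : ℕ} (hn : n = m + j)
    (h : c * R ^ j ≤ d * R ^ n) : c ≤ d * R ^ m := by
  rw [hn, pow_add, ← mul_assoc] at h
  exact le_of_mul_le_mul_right h (by positivity)

theorem two_mul_add_one_le {B : ℕ} (hB : 1 ≤ B) : (2 * B + 1 : ℝ) ≤ 3 * B := by
  have : (1 : ℝ) ≤ B := by exact_mod_cast hB
  linarith

theorem card_zeros_le (hn : Fintype.card ι = m + 2) {p : MvPolynomial ι ℤ} (hp : p ≠ 0) {B : ℕ}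
    (hB : 1 ≤ B) : (((box ι B).filter fun x ↦ MvPolynomial.eval x p = 0).card : ℝ) ≤
      p.totalDegree * (3 * B) ^ (m + 1) := by
  have h := card_zeros_mul_le hp B
  have h' : (((box ι B).filter fun x ↦ MvPolynomial.eval x p = 0).card : ℝ) *
      (2 * B + 1) ^ 1 ≤ p.totalDegree * (2 * B + 1) ^ Fintype.card ι := by
    rw [pow_one]; exact_mod_cast h
  refine (le_of_mul_le_mul_pow (by positivity) 1 hn h').trans ?_
  gcongr
  exact two_mul_add_one_le hB

theorem card_quad_eq_le (hn : Fintype.card ι = m + 2) {A : ι → ι → ℤ}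
    (hA : ∀ k l, A k l = A l k) {k l : ι} (hkl : A k l ≠ 0) (N : ℤ) {B : ℕ} (hB : 1 ≤ B) :
    (((box ι B).filter fun x ↦ quad A x = N).card : ℝ) ≤ 2 * (3 * B) ^ (m + 1) := by
  set p : MvPolynomial ι ℤ := ∑ k, ∑ l, .C (A k l) * (.X k * .X l) - .C N with hp
  have ev : ∀ x, MvPolynomial.eval x p = quad A x - N := by
    intro x; simp [hp, quad, mul_assoc]
  have hdeg : p.totalDegree ≤ 2 := by
    refine (MvPolynomial.totalDegree_sub _ _).trans
      (max_le ?_ ((MvPolynomial.totalDegree_C _).le.trans (Nat.zero_le _)))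
    refine MvPolynomial.totalDegree_finsetSum_le fun k _ ↦
      MvPolynomial.totalDegree_finsetSum_le fun l _ ↦
        (MvPolynomial.totalDegree_mul _ _).trans ?_
    have := MvPolynomial.totalDegree_mul (MvPolynomial.X k) (MvPolynomial.X l : MvPolynomial ι ℤ)
    rw [MvPolynomial.totalDegree_X, MvPolynomial.totalDegree_X] at this
    rw [MvPolynomial.totalDegree_C]
    omega
  have hp0 : p ≠ 0 := by
    intro h0
    have h1 : ∀ x, quad A x = N := fun x ↦ by
      have := ev x
      rw [h0, map_zero] at this
      linarith
    have h2 : N = 0 := by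
      rw [← h1 0]; simp [quad]
    exact hkl (eq_zero_of_quad_eq_zero hA (fun x ↦ (h1 x).trans h2) k l)
  have h := card_zeros_le hn hp0 hB
  simp only [ev, sub_eq_zero] at h
  refine h.trans ?_
  gcongr
  exact_mod_cast hdeg

theorem card_nondegenerate_quad_eq_le (hn : Fintype.card ι = m + 2) {i j : ι} (hij : i ≠ j)
    (ε : ℝ) (hε : 0 < ε) :
    ∃ K : ℝ, 0 < K ∧ ∀ (Y B : ℕ) (A : ι → ι → ℤ) (N : ℤ), 1 ≤ B → B ≤ Y → (∀ k l, |A k l| ≤ Y) →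
      (∀ k l, A k l = A l k) → |N| ≤ Y → N ≠ 0 → A i j ^ 2 - A i i * A j j ≠ 0 →
      (((box ι B).filter fun x ↦ quad A x = N).card : ℝ) ≤ K * (Y : ℝ) ^ ε * (3 * B) ^ m := by
  obtain ⟨K, hK, h⟩ := card_quadric_le ι i j hij ε hε
  refine ⟨K, hK, fun Y B A N hB hBY h1 h2 h3 h4 h5 ↦ ?_⟩
  refine (le_of_mul_le_mul_pow (by positivity) 2 hn
    (h Y B A N (hB.trans hBY) hBY h1 h2 h3 h4 h5)).trans ?_
  gcongr
  exact two_mul_add_one_le hB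

theorem exists_cubic_ne_zero {t : ι → ι → ι → ℤ} (h12 : ∀ i j k, t i j k = t j i k)
    (h23 : ∀ i j k, t i j k = t i k j) {a : ι → ℤ} {k l : ι} (ha : contract t a k l ≠ 0) :
    ∃ x, cubic t x ≠ 0 := by
  by_contra! h
  refine ha (eq_zero_of_quad_eq_zero (contract_symm h12 a) (fun b ↦ ?_) k l)
  have h1 := four_mul_cubic_sub h12 h23 (b + a) (b - a)
  have e1 : b + a - (b - a) = (2 : ℤ) • a := by funext i; simp; ring
  have e2 : b + a + (b - a) = (2 : ℤ) • b := by funext i; simp; ring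
  rw [h, h, h, e1, e2, quad_contract_smul, quad_smul] at h1
  linarith

theorem card_exceptional_le (hn : Fintype.card ι = m + 2) {t : ι → ι → ι → ℤ}
    (h12 : ∀ i j k, t i j k = t j i k)
    (h23 : ∀ i j k, t i j k = t i k j) {i j : ι} {e : ι → ℤ}
    (he : contract t e i j ^ 2 - contract t e i i * contract t e j j ≠ 0) :
    ∃ D : ℝ, 0 < D ∧ ∀ B : ℕ, 1 ≤ B → (((box ι B).filter fun a ↦
      (contract t a i j ^ 2 - contract t a i i * contract t a j j) * cubic t a = 0).card : ℝ) ≤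
        D * B ^ (m + 1) := by
  set l : ι → ι → MvPolynomial ι ℤ := fun k l ↦ ∑ m, .C (t k l m) * .X m with hl
  have evl : ∀ a k k', MvPolynomial.eval a (l k k') = contract t a k k' := by
    intro a k k'; simp [hl, contract]
  have evF : ∀ a, MvPolynomial.eval a (∑ k, ∑ k', l k k' * .X k * .X k') = cubic t a := by
    intro a; simp [cubic, quad, evl]
  have evp : ∀ a, MvPolynomial.eval a (l i j ^ 2 - l i i * l j j) =
      contract t a i j ^ 2 - contract t a i i * contract t a j j := by
    intro a; simp [evl]
  have hp : l i j ^ 2 - l i i * l j j ≠ 0 := by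
    intro h0
    apply he
    rw [← evp, h0, map_zero]
  have hF : (∑ k, ∑ k', l k k' * .X k * .X k' : MvPolynomial ι ℤ) ≠ 0 := by
    have hex : ∃ k k', contract t e k k' ≠ 0 := by
      by_contra! h
      apply he; simp [h]
    obtain ⟨k, k', hk⟩ := hex
    obtain ⟨x, hx⟩ := exists_cubic_ne_zero h12 h23 hk
    intro h0
    apply hx
    rw [← evF, h0, map_zero]
  set p := (l i j ^ 2 - l i i * l j j) * (∑ k, ∑ k', l k k' * .X k * .X k') with hpd
  refine ⟨(p.totalDegree + 1) * 3 ^ (m + 1), by positivity, fun B hB ↦ ?_⟩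
  have h := card_zeros_le hn (mul_ne_zero hp hF) hB
  simp only [map_mul, evF, evp] at h
  refine h.trans ?_
  rw [mul_pow, ← mul_assoc]
  gcongr
  linarith

theorem card_kernel_le (hn : Fintype.card ι = m + 2) {t : ι → ι → ι → ℤ}
    (h12 : ∀ i j k, t i j k = t j i k)
    (h23 : ∀ i j k, t i j k = t i k j) {i j : ι} (hij : i ≠ j) {e : ι → ℤ}
    (he : contract t e i j ^ 2 - contract t e i i * contract t e j j ≠ 0) {B : ℕ} (hB : 1 ≤ B) :
    (((box ι B).filter fun a ↦ ∀ k l, contract t a k l = 0).card : ℝ) ≤ (3 * B) ^ m := by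
  have hsum := fun g ↦ sum_eq_add_add_sum_subtype hij g
  have hcard : Fintype.card {k // k ≠ i ∧ k ≠ j} = m := by
    have h1 := hsum fun _ ↦ 1
    simp only [Finset.sum_const, Finset.card_univ, nsmul_eq_mul, mul_one, hn] at h1
    push_cast at h1
    have h2 : (Fintype.card {k // k ≠ i ∧ k ≠ j} : ℤ) = m := by linarith
    exact_mod_cast h2
  refine le_trans ?_
    (pow_le_pow_left₀ (by positivity) (two_mul_add_one_le hB) m)
  have h1 : ((box ι B).filter fun a ↦ ∀ k l, contract t a k l = 0).card ≤
      (box {k // k ≠ i ∧ k ≠ j} B).card := by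
    refine Finset.card_le_card_of_injOn (fun a k ↦ a k) ?_ ?_
    · intro a ha
      simp only [Finset.coe_filter, Set.mem_ofPred_eq, mem_box, Finset.mem_coe] at ha ⊢
      exact fun k ↦ ha.1 k
    · intro a ha a' ha' haa
      simp only [Finset.coe_filter, Set.mem_ofPred_eq] at ha ha'
      have hz : ∀ k : {k // k ≠ i ∧ k ≠ j}, (a - a') k = 0 := fun k ↦ by
        simpa [sub_eq_zero] using congrFun haa k
      have hker : ∀ k l, contract t (a - a') k l = 0 := fun k l ↦ by
        rw [contract_sub, ha.2, ha'.2, sub_zero]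
      have hL : ∀ k, ∑ l, contract t e k l * (a - a') l = 0 := by
        intro k
        have : ∑ l, contract t e k l * (a - a') l = ∑ l, contract t (a - a') k l * e l := by
          simp only [contract, Finset.sum_mul]
          rw [Finset.sum_comm]
          exact Finset.sum_congr rfl fun _ _ ↦ Finset.sum_congr rfl fun _ _ ↦ by rw [h23]; ring
        rw [this]
        simp [hker]
      have hL' : ∀ k, contract t e k i * (a - a') i + contract t e k j * (a - a') j = 0 := by
        intro k
        have := hL k
        rw [hsum, Finset.sum_eq_zero (fun l _ ↦ by rw [hz, mul_zero]), add_zero] at this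
        exact this
      have hi := hL' i
      have hj := hL' j
      rw [contract_symm h12 e j i] at hj
      have zi : (a - a') i = 0 := by
        refine (mul_eq_zero.mp ?_).resolve_left he
        linear_combination contract t e i j * hj - contract t e j j * hi
      have zj : (a - a') j = 0 := by
        refine (mul_eq_zero.mp ?_).resolve_left he
        linear_combination contract t e i j * hi - contract t e i i * hj
      funext k
      rw [← sub_eq_zero, ← Pi.sub_apply]
      by_cases hki : k = i
      · rw [hki, zi]
      by_cases hkj : k = j
      · rw [hkj, zj]
      exact hz ⟨k, hki, hkj⟩
  rw [card_box, hcard] at h1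
  exact_mod_cast h1

end Counting

section CubicCollisions

variable {ι : Type*} [Fintype ι] [DecidableEq ι] {m : ℕ}

theorem card_filter_product_eq_sum {α β : Type*} (S : Finset α) (S' : Finset β)
    (P : α × β → Prop) [DecidablePred P] :
    ((S ×ˢ S').filter P).card = ∑ a ∈ S, (S'.filter fun b ↦ P (a, b)).card := by
  simp only [Finset.card_filter, Finset.sum_product]

theorem sum_le_of_exceptions {α : Type*} (S : Finset α) (f : α → ℝ) (P Q : α → Prop)
    [DecidablePred P] [DecidablePred Q] {G E H : ℝ}
    (h : ∀ a ∈ S, f a ≤ G + (if P a then E else 0) + (if Q a then H else 0)) :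
    ∑ a ∈ S, f a ≤ S.card * G + (S.filter P).card * E + (S.filter Q).card * H := by
  refine (Finset.sum_le_sum h).trans (le_of_eq ?_)
  rw [Finset.sum_add_distrib, Finset.sum_add_distrib, ← Finset.sum_filter, ← Finset.sum_filter]
  simp only [Finset.sum_const, nsmul_eq_mul]

theorem abs_quad_le {A : ι → ι → ℤ} {a : ℤ} (hA : ∀ k l, |A k l| ≤ a) {B : ℕ} {x : ι → ℤ}
    (hx : x ∈ box ι B) : |quad A x| ≤ Fintype.card ι ^ 2 * a * B ^ 2 := by
  rw [mem_box] at hx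
  calc |quad A x| ≤ ∑ k, |∑ l, A k l * x k * x l| := Finset.abs_sum_le_sum_abs _ _
    _ ≤ ∑ k, ∑ l, |A k l * x k * x l| :=
      Finset.sum_le_sum fun k _ ↦ Finset.abs_sum_le_sum_abs _ _
    _ ≤ ∑ k : ι, ∑ l : ι, a * B * B := Finset.sum_le_sum fun k _ ↦ Finset.sum_le_sum fun l _ ↦ by
      have ha : 0 ≤ a := (abs_nonneg _).trans (hA k l)
      rw [abs_mul, abs_mul]
      exact mul_le_mul (mul_le_mul (hA k l) (hx k) (abs_nonneg _) ha) (hx l) (abs_nonneg _)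
        (by positivity)
    _ = _ := by simp; ring

theorem exists_abs_contract_le (t : ι → ι → ι → ℤ) :
    ∃ T : ℕ, 1 ≤ T ∧ ∀ (B : ℕ), ∀ a ∈ box ι B,
      (∀ k l, |contract t a k l| ≤ T * B) ∧ |cubic t a| ≤ T * B ^ 3 := by
  set T₀ : ℕ := ∑ k, ∑ l, ∑ m, (t k l m).natAbs with hT₀
  have h1 : ∀ (B : ℕ), ∀ a ∈ box ι B, ∀ k l, |contract t a k l| ≤ T₀ * B := by
    intro B a ha k l
    rw [mem_box] at ha
    have h2 : ∑ m, (t k l m).natAbs ≤ T₀ :=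
      (Finset.single_le_sum (f := fun l ↦ ∑ m, (t k l m).natAbs) (fun _ _ ↦ Nat.zero_le _)
        (Finset.mem_univ l)).trans (Finset.single_le_sum (f := fun k ↦ ∑ l, ∑ m, (t k l m).natAbs)
          (fun _ _ ↦ Nat.zero_le _) (Finset.mem_univ k))
    have h3 : ∑ m, |t k l m| ≤ T₀ := by
      have : ((∑ m, (t k l m).natAbs : ℕ) : ℤ) ≤ T₀ := by exact_mod_cast h2
      push_cast at this
      simpa using this
    calc |contract t a k l| ≤ ∑ m, |t k l m * a m| := Finset.abs_sum_le_sum_abs _ _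
      _ ≤ ∑ m, |t k l m| * B := Finset.sum_le_sum fun m _ ↦ by
        rw [abs_mul]; exact mul_le_mul_of_nonneg_left (ha m) (abs_nonneg _)
      _ = (∑ m, |t k l m|) * B := (Finset.sum_mul _ _ _).symm
      _ ≤ _ := by gcongr
  refine ⟨(Fintype.card ι ^ 2 + 1) * T₀ + 1, by omega, fun B a ha ↦ ⟨fun k l ↦ ?_, ?_⟩⟩
  · refine (h1 B a ha k l).trans ?_
    push_cast
    have : (0 : ℤ) ≤ Fintype.card ι ^ 2 * T₀ * B + B := by positivity
    linarith
  · refine (abs_quad_le (h1 B a ha) ha).trans ?_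
    push_cast
    have : (0 : ℤ) ≤ T₀ * B ^ 3 + B ^ 3 := by positivity
    linarith

theorem natCast_mul_pow_three_rpow (c B : ℕ) (ε : ℝ) :
    ((c * B ^ 3 : ℕ) : ℝ) ^ (ε / 3) = (c : ℝ) ^ (ε / 3) * (B : ℝ) ^ ε := by
  push_cast
  rw [Real.mul_rpow (by positivity) (by positivity), ← Real.rpow_natCast _ 3,
    ← Real.rpow_mul (by positivity)]
  congr 2
  push_cast; ring

theorem sub_mem_box {B : ℕ} {x y : ι → ℤ} (hx : x ∈ box ι B) (hy : y ∈ box ι B) :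
    x - y ∈ box ι (2 * B) := by
  rw [mem_box] at *
  intro k
  have h1 := abs_sub (x k) (y k)
  rw [Pi.sub_apply]
  push_cast
  linarith [hx k, hy k]

theorem add_mem_box {B : ℕ} {x y : ι → ℤ} (hx : x ∈ box ι B) (hy : y ∈ box ι B) :
    x + y ∈ box ι (2 * B) := by
  rw [mem_box] at *
  intro k
  have h1 := abs_add_le (x k) (y k)
  rw [Pi.add_apply]
  push_cast
  linarith [hx k, hy k]

theorem card_box_two_mul_le (hn : Fintype.card ι = m + 2) {B : ℕ} (hB : 1 ≤ B) :
    ((box ι (2 * B)).card : ℝ) ≤ (6 * B) ^ (m + 2) := by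
  rw [card_box, hn]
  have h1 : (1 : ℝ) ≤ B := by exact_mod_cast hB
  push_cast
  gcongr
  linarith

/-- The number of solutions of `F(x) = F(y)` in a box for a non-degenerate cubic form `F`. -/
theorem card_cubic_collisions_le (hn : Fintype.card ι = m + 2) {t : ι → ι → ι → ℤ}
    (h12 : ∀ i j k, t i j k = t j i k)
    (h23 : ∀ i j k, t i j k = t i k j) {i j : ι} (hij : i ≠ j) {e : ι → ℤ}
    (he : contract t e i j ^ 2 - contract t e i i * contract t e j j ≠ 0)
    (ε : ℝ) (hε : 0 < ε) :
    ∃ K : ℝ, 0 < K ∧ ∀ B : ℕ, 1 ≤ B → (((box ι B ×ˢ box ι B).filter fun p ↦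
      cubic t p.1 = cubic t p.2).card : ℝ) ≤ K * (B : ℝ) ^ ε * B ^ (2 * m + 2) := by
  obtain ⟨T, hT, hbd⟩ := exists_abs_contract_le t
  obtain ⟨K₁, hK₁, hquad⟩ := card_nondegenerate_quad_eq_le hn hij (ε / 3) (by positivity)
  obtain ⟨D, hD, hexc⟩ := card_exceptional_le hn h12 h23 he
  refine ⟨6 ^ (2 * m + 2) * K₁ * ((24 * T : ℕ) : ℝ) ^ (ε / 3) + 2 * D * 2 ^ (m + 1) * 6 ^ (m + 1) +
    6 ^ (2 * m + 2), by positivity, fun B hB ↦ ?_⟩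
  have hBR : (1 : ℝ) ≤ B := by exact_mod_cast hB
  have hX : (1 : ℝ) ≤ (B : ℝ) ^ ε := Real.one_le_rpow hBR hε.le
  have h2B : 1 ≤ 2 * B := by omega
  have hBZ : (1 : ℤ) ≤ B := by exact_mod_cast hB
  have hTZ : (1 : ℤ) ≤ T := by exact_mod_cast hT
  have hBB3 : (B : ℤ) ≤ B ^ 3 := by
    calc (B : ℤ) = B ^ 1 := (pow_one _).symm
      _ ≤ _ := pow_le_pow_right₀ hBZ (by norm_num)
  have hY : ((24 * T * B ^ 3 : ℕ) : ℤ) = 24 * T * B ^ 3 := by push_cast; ring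
  have hTB : (T : ℤ) * B ≤ T * B ^ 3 := by gcongr
  have hTB3 : (B : ℤ) ^ 3 ≤ T * B ^ 3 := by nlinarith
  have hYB : 2 * B ≤ 24 * T * B ^ 3 := by
    have : (2 * B : ℤ) ≤ 24 * T * B ^ 3 := by linarith
    exact_mod_cast this
  have hinj : ((box ι B ×ˢ box ι B).filter fun p ↦ cubic t p.1 = cubic t p.2).card ≤
      ((box ι (2 * B) ×ˢ box ι (2 * B)).filter fun p ↦
        quad (fun k l ↦ 3 * contract t p.1 k l) p.2 = -cubic t p.1).card := by
    refine Finset.card_le_card_of_injOn (fun p ↦ (p.1 - p.2, p.1 + p.2)) ?_ ?_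
    · intro p hp
      simp only [Finset.coe_filter, Set.mem_ofPred_eq, Finset.mem_product] at hp ⊢
      refine ⟨⟨sub_mem_box hp.1.1 hp.1.2, add_mem_box hp.1.1 hp.1.2⟩, ?_⟩
      have := four_mul_cubic_sub h12 h23 p.1 p.2
      rw [quad_mul_left]
      linarith [hp.2]
    · intro p _ q _ hpq
      simp only [Prod.mk.injEq] at hpq
      have h1 : ∀ k, p.1 k = q.1 k ∧ p.2 k = q.2 k := fun k ↦ by
        have e1 := congrFun hpq.1 k
        have e2 := congrFun hpq.2 k
        simp only [Pi.sub_apply, Pi.add_apply] at e1 e2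
        omega
      exact Prod.ext (funext fun k ↦ (h1 k).1) (funext fun k ↦ (h1 k).2)
  have hfib : ∀ a ∈ box ι (2 * B),
      (((box ι (2 * B)).filter fun b ↦
        quad (fun k l ↦ 3 * contract t a k l) b = -cubic t a).card : ℝ) ≤
      K₁ * (((24 * T : ℕ) : ℝ) ^ (ε / 3) * (B : ℝ) ^ ε) * (3 * ((2 * B : ℕ) : ℝ)) ^ m +
        (if (contract t a i j ^ 2 - contract t a i i * contract t a j j) * cubic t a = 0
          then 2 * (3 * ((2 * B : ℕ) : ℝ)) ^ (m + 1) else 0) +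
        (if ∀ k l, contract t a k l = 0 then (6 * (B : ℝ)) ^ (m + 2) else 0) := by
    intro a ha
    have hsymm : ∀ k l, 3 * contract t a k l = 3 * contract t a l k := fun k l ↦ by
      rw [contract_symm h12]
    by_cases hker : ∀ k l, contract t a k l = 0
    · rw [if_pos hker]
      have h1 : (((box ι (2 * B)).filter fun b ↦
          quad (fun k l ↦ 3 * contract t a k l) b = -cubic t a).card : ℝ) ≤ (6 * B) ^ (m + 2) :=
        le_trans (by exact_mod_cast Finset.card_filter_le _ _) (card_box_two_mul_le hn hB)
      refine h1.trans (le_add_of_nonneg_left (add_nonneg (by positivity) ?_))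
      split_ifs <;> positivity
    · rw [if_neg hker, add_zero]
      push Not at hker
      obtain ⟨k, l, hkl⟩ := hker
      split_ifs with hz
      · exact (card_quad_eq_le hn hsymm (mul_ne_zero three_ne_zero hkl) _ h2B).trans
          (le_add_of_nonneg_left (by positivity))
      · rw [add_zero, ← natCast_mul_pow_three_rpow]
        obtain ⟨hz1, hz2⟩ := mul_ne_zero_iff.mp hz
        obtain ⟨b1, b2⟩ := hbd _ a ha
        push_cast at b1 b2
        refine hquad _ _ _ _ h2B hYB (fun k l ↦ ?_) hsymm ?_ (neg_ne_zero.mpr hz2) ?_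
        · rw [abs_mul, hY]
          have := b1 k l
          simp only [Nat.abs_ofNat]
          linarith
        · rw [abs_neg, hY]
          linarith
        · intro h0
          apply hz1
          linarith
  have hsum := sum_le_of_exceptions _ _ _ _ hfib
  have c1 := card_box_two_mul_le (ι := ι) hn hB
  have c2 := hexc (2 * B) h2B
  have c3 := card_kernel_le hn h12 h23 hij he h2B
  have hcast : (3 * ((2 * B : ℕ) : ℝ)) = 6 * B := by push_cast; ring
  rw [hcast] at hsum c3
  calc _ ≤ _ := Nat.cast_le.mpr hinj
    _ = ∑ a ∈ box ι (2 * B), (((box ι (2 * B)).filter fun b ↦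
        quad (fun k l ↦ 3 * contract t a k l) b = -cubic t a).card : ℝ) := by
      rw [card_filter_product_eq_sum]; push_cast; rfl
    _ ≤ _ := hsum
    _ ≤ (6 * B) ^ (m + 2) * (K₁ * (((24 * T : ℕ) : ℝ) ^ (ε / 3) * (B : ℝ) ^ ε) * (6 * B) ^ m) +
        D * ((2 * B : ℕ) : ℝ) ^ (m + 1) * (2 * (6 * B) ^ (m + 1)) +
        (6 * B) ^ m * (6 * B) ^ (m + 2) := by gcongr
    _ = 6 ^ (2 * m + 2) * K₁ * ((24 * T : ℕ) : ℝ) ^ (ε / 3) * (B : ℝ) ^ ε * B ^ (2 * m + 2) +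
        (2 * D * 2 ^ (m + 1) * 6 ^ (m + 1) + 6 ^ (2 * m + 2)) * 1 * B ^ (2 * m + 2) := by
      rw [show ((2 * B : ℕ) : ℝ) = 2 * B by push_cast; ring]; ring
    _ ≤ 6 ^ (2 * m + 2) * K₁ * ((24 * T : ℕ) : ℝ) ^ (ε / 3) * (B : ℝ) ^ ε * B ^ (2 * m + 2) +
        (2 * D * 2 ^ (m + 1) * 6 ^ (m + 1) + 6 ^ (2 * m + 2)) * (B : ℝ) ^ ε * B ^ (2 * m + 2) := by
      gcongr
    _ = _ := by ring

end CubicCollisions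

/-- The pairs whose difference is parallel to `e`, where `τ` is a coordinate with `e τ ≠ 0`. -/
def Parallel {ι : Type*} (e : ι → ℤ) (τ : ι) (p : (ι → ℤ) × (ι → ℤ)) : Prop :=
  e τ • (p.1 - p.2) = (p.1 τ - p.2 τ) • e

theorem Parallel.ext {ι : Type*} {e : ι → ℤ} {τ : ι} (hτ : e τ ≠ 0) {p q : (ι → ℤ) × (ι → ℤ)}
    (hp : Parallel e τ p) (hq : Parallel e τ q) (h1 : p.1 τ - p.2 τ = q.1 τ - q.2 τ)
    (h2 : p.1 + p.2 = q.1 + q.2) : p = q := by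
  have h : ∀ k, p.1 k = q.1 k ∧ p.2 k = q.2 k := by
    intro k
    have e1 := congrFun hp k
    have e2 := congrFun hq k
    have e3 := congrFun h2 k
    simp only [Pi.smul_apply, Pi.sub_apply, Pi.add_apply, smul_eq_mul] at e1 e2 e3
    have e4 : p.1 k - p.2 k = q.1 k - q.2 k := by
      apply mul_left_cancel₀ hτ
      rw [e1, e2, h1]
    omega
  exact Prod.ext (funext fun k ↦ (h k).1) (funext fun k ↦ (h k).2)

section QuadrupleCollisions

variable {ι : Type*} [Fintype ι] [DecidableEq ι] {m : ℕ}

theorem card_sub_eq_le {α : Type*} (S : Finset α) (f : α → ℤ) (N : ℤ) :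
    ((S ×ˢ S).filter fun p ↦ f p.1 - f p.2 = N).card ≤
      ((S ×ˢ S).filter fun p ↦ f p.1 = f p.2).card := by
  have h := sq_card_pairs_le S S f fun s ↦ f s + N
  simp only [add_left_inj] at h
  have h1 : ∀ p : α × α, f p.1 - f p.2 = N ↔ f p.1 = f p.2 + N := fun p ↦
    ⟨fun h ↦ by omega, fun h ↦ by omega⟩
  simp only [h1]
  rw [← sq] at h
  exact (Nat.pow_le_pow_iff_left two_ne_zero).mp h

/-- The pairs excluded from the divisor argument. -/
def Bad (t : ι → ι → ι → ℤ) (e : ι → ℤ) (τ : ι) (p : (ι → ℤ) × (ι → ℤ)) : Prop :=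
  p.1 τ - p.2 τ = 0 ∨ quad (contract t e) (p.1 + p.2) = 0 ∨
    3 * e τ ^ 2 * quad (contract t e) (p.1 + p.2) + (p.1 τ - p.2 τ) ^ 2 * cubic t e = 0

open Classical in
theorem card_bad_le (hn : Fintype.card ι = m + 2) {t : ι → ι → ι → ℤ}
    (h12 : ∀ i j k, t i j k = t j i k) {e : ι → ℤ} {τ : ι} (hτ : e τ ≠ 0) {k l : ι}
    (hkl : contract t e k l ≠ 0) {B : ℕ} (hB : 1 ≤ B) :
    (((box ι B ×ˢ box ι B).filter fun p ↦ Parallel e τ p ∧ Bad t e τ p).card : ℝ) ≤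
      5 * (6 * B) ^ (m + 2) := by
  have hBR : (1 : ℝ) ≤ B := by exact_mod_cast hB
  have h2B : 1 ≤ 2 * B := by omega
  have hcast : (3 * ((2 * B : ℕ) : ℝ)) = 6 * B := by push_cast; ring
  have hinj : ((box ι B ×ˢ box ι B).filter fun p ↦ Parallel e τ p ∧ Bad t e τ p).card ≤
      ((Finset.Icc (-((2 * B : ℕ) : ℤ)) (2 * B : ℕ) ×ˢ box ι (2 * B)).filter fun p ↦
        p.1 = 0 ∨ quad (contract t e) p.2 = 0 ∨
          3 * e τ ^ 2 * quad (contract t e) p.2 + p.1 ^ 2 * cubic t e = 0).card := by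
    refine Finset.card_le_card_of_injOn (fun p ↦ (p.1 τ - p.2 τ, p.1 + p.2)) ?_ ?_
    · intro p hp
      simp only [Finset.coe_filter, Set.mem_ofPred_eq, Finset.mem_product, Finset.mem_Icc] at hp ⊢
      refine ⟨⟨abs_le.mp (mem_box.mp (sub_mem_box hp.1.1 hp.1.2) τ),
        add_mem_box hp.1.1 hp.1.2⟩, hp.2.2⟩
    · intro p hp q hq hpq
      simp only [Finset.coe_filter, Set.mem_ofPred_eq] at hp hq
      simp only [Prod.mk.injEq] at hpq
      exact hp.2.1.ext hτ hq.2.1 hpq.1 hpq.2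
  have hfib : ∀ h ∈ Finset.Icc (-((2 * B : ℕ) : ℤ)) (2 * B : ℕ), (((box ι (2 * B)).filter fun b ↦
        h = 0 ∨ quad (contract t e) b = 0 ∨
          3 * e τ ^ 2 * quad (contract t e) b + h ^ 2 * cubic t e = 0).card : ℝ) ≤
      4 * (6 * (B : ℝ)) ^ (m + 1) + (if h = 0 then (6 * (B : ℝ)) ^ (m + 2) else 0) +
        (if False then 0 else 0) := by
    intro h _
    rw [if_neg not_false, add_zero]
    split_ifs with h0
    · refine le_trans ?_ (le_add_of_nonneg_left (by positivity))
      exact le_trans (by exact_mod_cast Finset.card_filter_le _ _) (card_box_two_mul_le hn hB)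
    · rw [add_zero]
      have h1 := card_quad_eq_le hn (contract_symm h12 e) hkl 0 h2B
      have h2 := card_quad_eq_le hn (A := fun k l ↦ 3 * e τ ^ 2 * contract t e k l)
        (fun k l ↦ by rw [contract_symm h12])
        (mul_ne_zero (mul_ne_zero three_ne_zero (pow_ne_zero 2 hτ)) hkl)
        (-(h ^ 2 * cubic t e)) h2B
      rw [hcast] at h1 h2
      have h3 : ((box ι (2 * B)).filter fun b ↦ h = 0 ∨ quad (contract t e) b = 0 ∨
          3 * e τ ^ 2 * quad (contract t e) b + h ^ 2 * cubic t e = 0) ⊆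
          ((box ι (2 * B)).filter fun b ↦ quad (contract t e) b = 0) ∪
          ((box ι (2 * B)).filter fun b ↦
            quad (fun k l ↦ 3 * e τ ^ 2 * contract t e k l) b = -(h ^ 2 * cubic t e)) := by
        intro b hb
        simp only [Finset.mem_filter, Finset.mem_union, quad_mul_left] at hb ⊢
        rcases hb.2 with h4 | h4 | h4
        · exact absurd h4 h0
        · exact Or.inl ⟨hb.1, h4⟩
        · exact Or.inr ⟨hb.1, by linarith⟩
      have h4 := (Nat.cast_le (α := ℝ)).mpr
        ((Finset.card_le_card h3).trans (Finset.card_union_le _ _))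
      push_cast at h4
      linarith
  have hsum := sum_le_of_exceptions _ _ _ _ hfib
  have hone : ((Finset.Icc (-((2 * B : ℕ) : ℤ)) (2 * B : ℕ)).filter fun h ↦ h = 0).card ≤ 1 :=
    Finset.card_le_one.mpr fun a ha b hb ↦ by
      rw [(Finset.mem_filter.mp ha).2, (Finset.mem_filter.mp hb).2]
  have hone' : (((Finset.Icc (-((2 * B : ℕ) : ℤ)) (2 * B : ℕ)).filter fun h ↦ h = 0).card : ℝ) ≤
    1 := by exact_mod_cast hone
  have hIcc : ((Finset.Icc (-((2 * B : ℕ) : ℤ)) (2 * B : ℕ)).card : ℝ) ≤ 6 * B := by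
    rw [card_Icc_neg]; push_cast; linarith
  calc _ ≤ _ := Nat.cast_le.mpr hinj
    _ = _ := by rw [card_filter_product_eq_sum]; push_cast; rfl
    _ ≤ _ := hsum
    _ ≤ 6 * B * (4 * (6 * (B : ℝ)) ^ (m + 1)) + 1 * (6 * (B : ℝ)) ^ (m + 2) := by
      rw [mul_zero, add_zero]
      gcongr
    _ = _ := by ring

open Classical in
theorem card_good_eq_le (hn : Fintype.card ι = m + 2) {t : ι → ι → ι → ℤ}
    (h12 : ∀ i j k, t i j k = t j i k)
    (h23 : ∀ i j k, t i j k = t i k j) {i j : ι} (hij : i ≠ j) {e : ι → ℤ}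
    (he : contract t e i j ^ 2 - contract t e i i * contract t e j j ≠ 0)
    {τ : ι} (hτ : e τ ≠ 0) (ε : ℝ) (hε : 0 < ε) :
    ∃ K : ℝ, 0 < K ∧ ∀ B : ℕ, 1 ≤ B → ∀ N : ℤ, (((box ι B ×ˢ box ι B).filter fun p ↦
      Parallel e τ p ∧ ¬ Bad t e τ p ∧ cubic t p.1 - cubic t p.2 = N).card : ℝ) ≤
        K * (B : ℝ) ^ ε * B ^ m := by
  obtain ⟨T, hT, hbd⟩ := exists_abs_contract_le t
  obtain ⟨K₁, hK₁, hquad⟩ := card_nondegenerate_quad_eq_le hn hij (ε / 2 / 3) (by positivity)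
  obtain ⟨K₂, hK₂, hdiv⟩ := card_divisors_le_rpow (ε / 2 / 3) (by positivity)
  set E : ℕ := ∑ k, (e k).natAbs with hE
  have heE : e ∈ box ι E := mem_box.mpr fun k ↦ by
    have := Finset.single_le_sum (f := fun k ↦ (e k).natAbs) (fun _ _ ↦ Nat.zero_le _)
      (Finset.mem_univ k)
    rw [Int.abs_eq_natAbs]
    exact_mod_cast this
  set n := Fintype.card ι with hnn
  set W : ℕ := 4 * n ^ 2 * (T * E) + T * E + 2 with hW
  set V : ℕ := 4 * (e τ).natAbs ^ 3 * (2 * T) with hV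
  refine ⟨2 * K₂ * (V : ℝ) ^ (ε / 2 / 3) * K₁ * (W : ℝ) ^ (ε / 2 / 3) * 6 ^ m + 1,
    by positivity, fun B hB N ↦ ?_⟩
  have hBR : (1 : ℝ) ≤ B := by exact_mod_cast hB
  have hBZ : (1 : ℤ) ≤ B := by exact_mod_cast hB
  have h2B : 1 ≤ 2 * B := by omega
  have hcast : (3 * ((2 * B : ℕ) : ℝ)) = 6 * B := by push_cast; ring
  set S := (box ι B ×ˢ box ι B).filter fun p ↦
      Parallel e τ p ∧ ¬ Bad t e τ p ∧ cubic t p.1 - cubic t p.2 = N with hS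
  have hmem : ∀ p ∈ S, p.1 ∈ box ι B ∧ p.2 ∈ box ι B ∧ Parallel e τ p ∧ ¬ Bad t e τ p ∧
      cubic t p.1 - cubic t p.2 = N := by
    intro p hp
    obtain ⟨h1, h2⟩ := Finset.mem_filter.mp hp
    exact ⟨(Finset.mem_product.mp h1).1, (Finset.mem_product.mp h1).2, h2⟩
  have hid : ∀ p ∈ S, 4 * e τ ^ 3 * N = (p.1 τ - p.2 τ) * (3 * e τ ^ 2 *
      quad (contract t e) (p.1 + p.2) + (p.1 τ - p.2 τ) ^ 2 * cubic t e) := by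
    intro p hp
    obtain ⟨-, -, h3, -, h5⟩ := hmem p hp
    rw [← h5]
    exact mul_cubic_sub h12 h23 h3
  have hBm : (0 : ℝ) ≤ 2 * K₂ * (V : ℝ) ^ (ε / 2 / 3) * K₁ * (W : ℝ) ^ (ε / 2 / 3) * 6 ^ m := by
    positivity
  rcases S.eq_empty_or_nonempty with h0 | ⟨p₀, hp₀⟩
  · rw [h0, Finset.card_empty, Nat.cast_zero]; positivity
  have hN0 : 4 * e τ ^ 3 * N ≠ 0 := by
    rw [hid p₀ hp₀]
    obtain ⟨-, -, -, h4, -⟩ := hmem p₀ hp₀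
    simp only [Bad, not_or] at h4
    exact mul_ne_zero h4.1 h4.2.2
  have hNle : (4 * e τ ^ 3 * N).natAbs ≤ V * B ^ 3 := by
    obtain ⟨h1, h2, -, -, h5⟩ := hmem p₀ hp₀
    have h3 : |N| ≤ 2 * T * B ^ 3 := by
      rw [← h5]
      have := abs_sub (cubic t p₀.1) (cubic t p₀.2)
      linarith [(hbd B _ h1).2, (hbd B _ h2).2]
    have h4 : N.natAbs ≤ 2 * T * B ^ 3 := by
      rw [Int.abs_eq_natAbs] at h3
      exact_mod_cast h3
    rw [Int.natAbs_mul, Int.natAbs_mul, Int.natAbs_pow, hV, mul_assoc _ (2 * T)]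
    exact Nat.mul_le_mul_left _ h4
  set Dv := (4 * e τ ^ 3 * N).natAbs.divisors with hDv
  set H : Finset ℤ := Dv.image (fun d : ℕ ↦ (d : ℤ)) ∪ Dv.image (fun d : ℕ ↦ -(d : ℤ)) with hH
  have hHcard : (H.card : ℝ) ≤ 2 * (K₂ * ((V : ℝ) ^ (ε / 2 / 3) * (B : ℝ) ^ (ε / 2))) := by
    have h1 : H.card ≤ 2 * Dv.card := by
      calc H.card ≤ _ := Finset.card_union_le _ _
        _ ≤ Dv.card + Dv.card := Nat.add_le_add Finset.card_image_le Finset.card_image_le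
        _ = 2 * Dv.card := (two_mul _).symm
    have h2 : (H.card : ℝ) ≤ 2 * Dv.card := by exact_mod_cast h1
    refine h2.trans (mul_le_mul_of_nonneg_left ?_ zero_le_two)
    refine (hdiv _ (Int.natAbs_ne_zero.mpr hN0)).trans ?_
    rw [← natCast_mul_pow_three_rpow]
    exact mul_le_mul_of_nonneg_left
      (Real.rpow_le_rpow (by positivity) (by exact_mod_cast hNle) (by positivity)) hK₂.le
  have hmaps : ∀ p ∈ S, p.1 τ - p.2 τ ∈ H := by
    intro p hp
    have hd : (p.1 τ - p.2 τ).natAbs ∈ Dv := by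
      rw [hDv, Nat.mem_divisors]
      exact ⟨Int.natAbs_dvd_natAbs.mpr ⟨_, hid p hp⟩, Int.natAbs_ne_zero.mpr hN0⟩
    rw [hH, Finset.mem_union, Finset.mem_image, Finset.mem_image]
    rcases Int.natAbs_eq (p.1 τ - p.2 τ) with h | h
    · exact Or.inl ⟨_, hd, h.symm⟩
    · exact Or.inr ⟨_, hd, h.symm⟩
  have hBB3 : (B : ℤ) ≤ B ^ 3 := by
    calc (B : ℤ) = B ^ 1 := (pow_one _).symm
      _ ≤ _ := pow_le_pow_right₀ hBZ (by norm_num)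
  have hB23 : (B : ℤ) ^ 2 ≤ B ^ 3 := pow_le_pow_right₀ hBZ (by norm_num)
  have hWB : ((W * B ^ 3 : ℕ) : ℤ) = 4 * n ^ 2 * (T * E) * B ^ 3 + T * E * B ^ 3 + 2 * B ^ 3 := by
    rw [hW]; push_cast; ring
  have hpos1 : (0 : ℤ) ≤ 4 * n ^ 2 * (T * E) * B ^ 3 := by positivity
  have hpos2 : (0 : ℤ) ≤ T * E * B ^ 3 := by positivity
  have hpos3 : (0 : ℤ) ≤ B ^ 3 := by positivity
  have hfib : ∀ h ∈ H, ((S.filter fun p ↦ p.1 τ - p.2 τ = h).card : ℝ) ≤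
      K₁ * ((W : ℝ) ^ (ε / 2 / 3) * (B : ℝ) ^ (ε / 2)) * (6 * B) ^ m := by
    intro h _
    rcases (S.filter fun p ↦ p.1 τ - p.2 τ = h).eq_empty_or_nonempty with h0 | ⟨p₁, hp₁⟩
    · rw [h0, Finset.card_empty, Nat.cast_zero]; positivity
    obtain ⟨hp₁S, hp₁h⟩ := Finset.mem_filter.mp hp₁
    obtain ⟨g1, g2, g3, g4, g5⟩ := hmem p₁ hp₁S
    simp only [Bad, not_or] at g4
    obtain ⟨g4, g6, -⟩ := g4
    rw [hp₁h] at g4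
    have hinj : (S.filter fun p ↦ p.1 τ - p.2 τ = h).card ≤
        ((box ι (2 * B)).filter fun b ↦
          quad (contract t e) b = quad (contract t e) (p₁.1 + p₁.2)).card := by
      refine Finset.card_le_card_of_injOn (fun p ↦ p.1 + p.2) ?_ ?_
      · intro p hp
        simp only [Finset.coe_filter, Set.mem_ofPred_eq] at hp ⊢
        obtain ⟨f1, f2, -, -, -⟩ := hmem p hp.1
        refine ⟨add_mem_box f1 f2, ?_⟩
        have i1 := hid p hp.1
        have i2 := hid p₁ hp₁S
        rw [hp.2] at i1
        rw [hp₁h] at i2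
        have i3 := mul_left_cancel₀ g4 (i1.symm.trans i2)
        have i4 : (3 : ℤ) * e τ ^ 2 ≠ 0 := mul_ne_zero three_ne_zero (pow_ne_zero 2 hτ)
        exact mul_left_cancel₀ i4 (add_right_cancel i3)
      · intro p hp q hq hpq
        simp only [Finset.coe_filter, Set.mem_ofPred_eq] at hp hq
        exact (hmem p hp.1).2.2.1.ext hτ (hmem q hq.1).2.2.1 (hp.2.trans hq.2.symm) hpq
    refine (Nat.cast_le.mpr hinj).trans ?_
    rw [← natCast_mul_pow_three_rpow, ← hcast]
    refine hquad _ _ _ _ h2B ?_ (fun k l ↦ ?_) (contract_symm h12 e) ?_ g6 he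
    · have : ((2 * B : ℕ) : ℤ) ≤ (W * B ^ 3 : ℕ) := by rw [hWB]; push_cast; linarith
      exact_mod_cast this
    · refine ((hbd E e heE).1 k l).trans ?_
      rw [hWB]
      have : (T : ℤ) * E * 1 ≤ T * E * B ^ 3 := by
        gcongr
        exact hBZ.trans hBB3
      linarith
    · refine (abs_quad_le (hbd E e heE).1 (add_mem_box g1 g2)).trans ?_
      rw [hWB, ← hnn]
      have : (n : ℤ) ^ 2 * (T * E) * (4 * B ^ 2) ≤ n ^ 2 * (T * E) * (4 * B ^ 3) := by gcongr
      push_cast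
      linarith
  calc (S.card : ℝ) = ∑ h ∈ H, ((S.filter fun p ↦ p.1 τ - p.2 τ = h).card : ℝ) := by
        rw [Finset.card_eq_sum_card_fiberwise (f := fun p : (ι → ℤ) × (ι → ℤ) ↦ p.1 τ - p.2 τ)
          (t := H) hmaps]
        push_cast; rfl
    _ ≤ ∑ h ∈ H, K₁ * ((W : ℝ) ^ (ε / 2 / 3) * (B : ℝ) ^ (ε / 2)) * (6 * B) ^ m :=
      Finset.sum_le_sum hfib
    _ = H.card * (K₁ * ((W : ℝ) ^ (ε / 2 / 3) * (B : ℝ) ^ (ε / 2)) * (6 * B) ^ m) := by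
      rw [Finset.sum_const, nsmul_eq_mul]
    _ ≤ 2 * (K₂ * ((V : ℝ) ^ (ε / 2 / 3) * (B : ℝ) ^ (ε / 2))) *
        (K₁ * ((W : ℝ) ^ (ε / 2 / 3) * (B : ℝ) ^ (ε / 2)) * (6 * B) ^ m) := by gcongr
    _ = 2 * K₂ * (V : ℝ) ^ (ε / 2 / 3) * K₁ * (W : ℝ) ^ (ε / 2 / 3) * 6 ^ m *
        (B : ℝ) ^ ε * B ^ m := by
      have : (B : ℝ) ^ ε = (B : ℝ) ^ (ε / 2) * (B : ℝ) ^ (ε / 2) := by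
        rw [← Real.rpow_add (by positivity), add_halves]
      rw [this]; ring
    _ ≤ _ := by
      have : (0 : ℝ) ≤ 1 := zero_le_one
      gcongr
      linarith

end QuadrupleCollisions

section QuadrupleCount

variable {ι : Type*} [Fintype ι] [DecidableEq ι] {m : ℕ}

theorem card_image_parallel_le (hn : Fintype.card ι = m + 2) {e : ι → ℤ} {E : ℕ} (hE : 1 ≤ E)
    (he : e ∈ box ι E) (τ : ι) {B : ℕ} (hB : 1 ≤ B) :
    (((box ι B).image fun x k ↦ e τ * x k - e k * x τ).card : ℝ) ≤ (6 * E * B) ^ (m + 1) := by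
  have hsub : ((box ι B).image fun x k ↦ e τ * x k - e k * x τ) ⊆
      (box ι (2 * E * B)).filter fun y ↦ MvPolynomial.eval y (MvPolynomial.X τ) = 0 := by
    intro y hy
    obtain ⟨x, hx, rfl⟩ := Finset.mem_image.mp hy
    rw [mem_box] at hx he
    simp only [Finset.mem_filter, mem_box, MvPolynomial.eval_X]
    refine ⟨fun k ↦ ?_, by ring⟩
    have h1 : ∀ k l, |e k * x l| ≤ E * B := fun k l ↦ by
      rw [abs_mul]
      exact mul_le_mul (he k) (hx l) (abs_nonneg _) (by positivity)
    have := abs_sub (e τ * x k) (e k * x τ)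
    push_cast
    linarith [h1 τ k, h1 k τ]
  have h2 := card_zeros_le hn (MvPolynomial.X_ne_zero (R := ℤ) τ) (B := 2 * E * B)
    (Nat.mul_pos (Nat.mul_pos two_pos hE) hB)
  rw [MvPolynomial.totalDegree_X] at h2
  calc _ ≤ _ := Nat.cast_le.mpr (Finset.card_le_card hsub)
    _ ≤ _ := h2
    _ = _ := by push_cast; rw [one_mul]; congr 1; ring

/-- The number of solutions of `F(x) + F(v) = F(y) + F(u)` in a box for a non-degenerate
cubic form `F`. -/
theorem card_cubic_quadruples_le (hn : Fintype.card ι = m + 2) {t : ι → ι → ι → ℤ}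
    (h12 : ∀ i j k, t i j k = t j i k)
    (h23 : ∀ i j k, t i j k = t i k j) {i j : ι} (hij : i ≠ j) {e : ι → ℤ}
    (he : contract t e i j ^ 2 - contract t e i i * contract t e j j ≠ 0)
    (ε : ℝ) (hε : 0 < ε) :
    ∃ K : ℝ, 0 < K ∧ ∀ B : ℕ, 1 ≤ B →
      ((((box ι B ×ˢ box ι B) ×ˢ (box ι B ×ˢ box ι B)).filter fun p ↦
        cubic t p.1.1 + cubic t p.1.2 = cubic t p.2.1 + cubic t p.2.2).card : ℝ) ≤
          K * (B : ℝ) ^ ε * B ^ (4 * m + 5) := by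
  classical
  obtain ⟨k, l, hkl⟩ : ∃ k k', contract t e k k' ≠ 0 := by
    by_contra! h
    apply he; simp [h]
  obtain ⟨τ, hτ⟩ : ∃ τ, e τ ≠ 0 := by
    by_contra! h
    apply hkl; simp [contract, h]
  set E : ℕ := ∑ k, (e k).natAbs with hE
  have heE : e ∈ box ι E := mem_box.mpr fun k ↦ by
    have := Finset.single_le_sum (f := fun k ↦ (e k).natAbs) (fun _ _ ↦ Nat.zero_le _)
      (Finset.mem_univ k)
    rw [Int.abs_eq_natAbs]
    exact_mod_cast this
  have hE1 : 1 ≤ E := by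
    have h1 := mem_box.mp heE τ
    have h2 : 0 < |e τ| := abs_pos.mpr hτ
    have h3 : (1 : ℤ) ≤ E := by linarith
    exact_mod_cast h3
  obtain ⟨K₁, hK₁, hM⟩ := card_cubic_collisions_le hn h12 h23 hij he ε hε
  obtain ⟨K₂, hK₂, hgood⟩ := card_good_eq_le hn h12 h23 hij he hτ ε hε
  refine ⟨(6 * E) ^ (m + 1) * (5 * 6 ^ (m + 2) * K₁ + 3 ^ (2 * (m + 2)) * K₂), by positivity,
    fun B hB ↦ ?_⟩
  set S := box ι B ×ˢ box ι B with hS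
  set φ : (ι → ℤ) × (ι → ℤ) → ι → ℤ := fun p k ↦ e τ * p.1 k - e k * p.1 τ with hφ
  have hcoll := card_collisions_le S (fun p ↦ cubic t p.1 + cubic t p.2) φ
  have himg : ((S.image φ).card : ℝ) ≤ (6 * E * B) ^ (m + 1) := by
    refine le_trans ?_ (card_image_parallel_le hn hE1 heE τ hB)
    refine Nat.cast_le.mpr (Finset.card_le_card ?_)
    intro y hy
    obtain ⟨p, hp, rfl⟩ := Finset.mem_image.mp hy
    exact Finset.mem_image.mpr ⟨p.1, (Finset.mem_product.mp hp).1, rfl⟩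
  have hφP : ∀ p q : (ι → ℤ) × (ι → ℤ), φ p = φ q → Parallel e τ (p.1, q.1) := by
    intro p q h
    funext k
    have := congrFun h k
    simp only [hφ] at this
    simp only [Pi.smul_apply, Pi.sub_apply, smul_eq_mul]
    linarith
  have hsplit : ((S ×ˢ S).filter fun p ↦ cubic t p.1.1 + cubic t p.1.2 =
      cubic t p.2.1 + cubic t p.2.2 ∧ φ p.1 = φ p.2).card ≤
      ((S.filter fun p ↦ Parallel e τ p ∧ Bad t e τ p) ×ˢ S |>.filter fun p ↦
        cubic t p.2.1 - cubic t p.2.2 = cubic t p.1.1 - cubic t p.1.2).card +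
      ((S ×ˢ S).filter fun p ↦ Parallel e τ p.2 ∧ ¬ Bad t e τ p.2 ∧
        cubic t p.2.1 - cubic t p.2.2 = cubic t p.1.1 - cubic t p.1.2).card := by
    rw [← Finset.card_filter_add_card_filter_not (s := (S ×ˢ S).filter fun p ↦
      cubic t p.1.1 + cubic t p.1.2 = cubic t p.2.1 + cubic t p.2.2 ∧ φ p.1 = φ p.2)
      (fun p ↦ Bad t e τ (p.1.1, p.2.1))]
    refine Nat.add_le_add ?_ ?_
    · refine Finset.card_le_card_of_injOn
        (fun p ↦ ((p.1.1, p.2.1), (p.2.2, p.1.2))) ?_ ?_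
      · intro p hp
        simp only [hS, Finset.coe_filter, Finset.mem_filter, Set.mem_ofPred_eq,
          Finset.mem_product] at hp ⊢
        obtain ⟨⟨⟨⟨a1, a2⟩, a3, a4⟩, a5, a6⟩, a7⟩ := hp
        exact ⟨⟨⟨⟨a1, a3⟩, hφP _ _ a6, a7⟩, a4, a2⟩, by linarith⟩
      · intro p _ q _ hpq
        simp only [Prod.mk.injEq] at hpq
        exact Prod.ext (Prod.ext hpq.1.1 hpq.2.2) (Prod.ext hpq.1.2 hpq.2.1)
    · refine Finset.card_le_card_of_injOn
        (fun p ↦ ((p.2.2, p.1.2), (p.1.1, p.2.1))) ?_ ?_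
      · intro p hp
        simp only [hS, Finset.coe_filter, Finset.mem_filter, Set.mem_ofPred_eq,
          Finset.mem_product] at hp ⊢
        obtain ⟨⟨⟨⟨a1, a2⟩, a3, a4⟩, a5, a6⟩, a7⟩ := hp
        exact ⟨⟨⟨a4, a2⟩, a1, a3⟩, hφP _ _ a6, a7, by linarith⟩
      · intro p _ q _ hpq
        simp only [Prod.mk.injEq] at hpq
        exact Prod.ext (Prod.ext hpq.2.1 hpq.1.2) (Prod.ext hpq.2.2 hpq.1.1)
  have hbad : ((((S.filter fun p ↦ Parallel e τ p ∧ Bad t e τ p) ×ˢ S).filter fun p ↦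
        cubic t p.2.1 - cubic t p.2.2 = cubic t p.1.1 - cubic t p.1.2).card : ℝ) ≤
      5 * (6 * B) ^ (m + 2) * (K₁ * (B : ℝ) ^ ε * B ^ (2 * m + 2)) := by
    rw [card_filter_product_eq_sum]
    push_cast
    calc _ ≤ ∑ p ∈ S.filter fun p ↦ Parallel e τ p ∧ Bad t e τ p,
          K₁ * (B : ℝ) ^ ε * B ^ (2 * m + 2) := Finset.sum_le_sum fun p _ ↦
            (Nat.cast_le.mpr (card_sub_eq_le _ _ _)).trans (hM B hB)
      _ = _ := by rw [Finset.sum_const, nsmul_eq_mul]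
      _ ≤ _ := mul_le_mul_of_nonneg_right (card_bad_le hn h12 hτ hkl hB) (by positivity)
  have hSc : (S.card : ℝ) ≤ (3 * B) ^ (2 * (m + 2)) := by
    have h3 := pow_le_pow_left₀ (by positivity : (0 : ℝ) ≤ 2 * B + 1)
      (two_mul_add_one_le hB) (m + 2)
    calc (S.card : ℝ) = (2 * B + 1) ^ (m + 2) * (2 * B + 1) ^ (m + 2) := by
          rw [hS, Finset.card_product, card_box, hn]; push_cast; ring
      _ ≤ (3 * B) ^ (m + 2) * (3 * B) ^ (m + 2) :=
          mul_le_mul h3 h3 (by positivity) (by positivity)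
      _ = _ := by ring
  have hgd : (((S ×ˢ S).filter fun p ↦ Parallel e τ p.2 ∧ ¬ Bad t e τ p.2 ∧
        cubic t p.2.1 - cubic t p.2.2 = cubic t p.1.1 - cubic t p.1.2).card : ℝ) ≤
      (3 * B) ^ (2 * (m + 2)) * (K₂ * (B : ℝ) ^ ε * B ^ m) := by
    rw [card_filter_product_eq_sum]
    push_cast
    calc _ ≤ ∑ p ∈ S, K₂ * (B : ℝ) ^ ε * B ^ m := Finset.sum_le_sum fun p _ ↦ hgood B hB _
      _ = _ := by rw [Finset.sum_const, nsmul_eq_mul]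
      _ ≤ _ := mul_le_mul_of_nonneg_right hSc (by positivity)
  have hsplit' := (Nat.cast_le (α := ℝ)).mpr hsplit
  rw [Nat.cast_add] at hsplit'
  calc _ ≤ _ := Nat.cast_le.mpr hcoll
    _ = _ := Nat.cast_mul _ _
    _ ≤ (6 * E * B) ^ (m + 1) * (5 * (6 * B) ^ (m + 2) * (K₁ * (B : ℝ) ^ ε * B ^ (2 * m + 2)) +
        (3 * B) ^ (2 * (m + 2)) * (K₂ * (B : ℝ) ^ ε * B ^ m)) :=
      mul_le_mul himg (hsplit'.trans (add_le_add hbad hgd)) (by positivity) (by positivity)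
    _ = _ := by ring

end QuadrupleCount

section PowerDifference

theorem eq_of_pow_sub_pow_eq {k : ℕ} (hk : k = 3 ∨ k = 4) {x y x' y' M : ℤ} (hM : M ≠ 0)
    (h : y ^ k - x ^ k = M) (h' : y' ^ k - x' ^ k = M) (hd : y - x = y' - x')
    (hs : 0 ≤ y + x ↔ 0 ≤ y' + x') : x = x' ∧ y = y' := by
  obtain ⟨d, rfl⟩ : ∃ d, y = x + d := ⟨y - x, by ring⟩
  obtain rfl : y' = x' + d := by linarith
  have hd0 : d ≠ 0 := by
    rintro rfl
    apply hM
    rw [← h]; ring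
  suffices x = x' by subst this; exact ⟨rfl, rfl⟩
  rcases hk with rfl | rfl
  · have h1 : d * (3 * ((x - x') * (x + d + x + (x' + d + x')))) = 0 := by
      linear_combination 2 * h - 2 * h'
    have h2 := (mul_eq_zero.mp ((mul_eq_zero.mp h1).resolve_left hd0)).resolve_left three_ne_zero
    rcases mul_eq_zero.mp h2 with h3 | h3
    · linarith
    · by_cases hc : 0 ≤ x + d + x
      · have := hs.mp hc
        linarith
      · have := mt hs.mpr hc
        push Not at hc this
        linarith
  · have h1 : d * ((x - x') * ((2 * x + d) ^ 2 + (2 * x + d) * (2 * x' + d) + (2 * x' + d) ^ 2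
        + d ^ 2)) = 0 := by
      linear_combination h - h'
    have h2 := (mul_eq_zero.mp h1).resolve_left hd0
    rcases mul_eq_zero.mp h2 with h3 | h3
    · linarith
    · have := pow_pos (abs_pos.mpr hd0) 2
      rw [sq_abs] at this
      nlinarith [sq_nonneg ((2 * x + d) + (2 * x' + d)), sq_nonneg (2 * x + d),
        sq_nonneg (2 * x' + d)]

theorem card_pow_sub_pow_eq_le {k : ℕ} (hk : k = 3 ∨ k = 4) {M : ℤ} (hM : M ≠ 0)
    (T : Finset (ℤ × ℤ)) (hT : ∀ p ∈ T, p.2 ^ k - p.1 ^ k = M) :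
    T.card ≤ 4 * M.natAbs.divisors.card := by
  have h : T.card ≤ (M.natAbs.divisors ×ˢ (Finset.univ : Finset (Bool × Bool))).card := by
    refine Finset.card_le_card_of_injOn
      (fun p ↦ ((p.2 - p.1).natAbs, (decide (0 ≤ p.2 - p.1), decide (0 ≤ p.2 + p.1)))) ?_ ?_
    · intro p hp
      simp only [Finset.coe_product, Set.mem_prod, Finset.mem_coe, Nat.mem_divisors,
        Finset.mem_univ, and_true]
      refine ⟨Int.natAbs_dvd_natAbs.mpr ?_, Int.natAbs_ne_zero.mpr hM⟩
      rw [← hT p hp]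
      exact sub_dvd_pow_sub_pow _ _ _
    · intro p hp q hq hpq
      simp only [Prod.mk.injEq, decide_eq_decide] at hpq
      obtain ⟨h1, h2, h3⟩ := hpq
      have hd : p.2 - p.1 = q.2 - q.1 := by omega
      have := eq_of_pow_sub_pow_eq hk hM (hT p hp) (hT q hq) hd h3
      exact Prod.ext this.1 this.2
  rw [Finset.card_product] at h
  simpa [mul_comm] using h

theorem card_mul_pow_sub_pow_eq_le {k : ℕ} (hk : k = 3 ∨ k = 4) {c : ℤ} (hc : c ≠ 0)
    (ε : ℝ) (hε : 0 < ε) :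
    ∃ K : ℝ, 0 < K ∧ ∀ q : ℕ, 1 ≤ q → ∀ N : ℤ, N ≠ 0 →
      (((Finset.Icc (-q : ℤ) q ×ˢ Finset.Icc (-q : ℤ) q).filter fun p ↦
        c * (p.2 ^ k - p.1 ^ k) = N).card : ℝ) ≤ K * (q : ℝ) ^ ε := by
  obtain ⟨K, hK, hdiv⟩ := card_divisors_le_rpow (ε / 4) (by positivity)
  refine ⟨4 * (K * 2 ^ (ε / 4)), by positivity, fun q hq N hN ↦ ?_⟩
  set T := (Finset.Icc (-q : ℤ) q ×ˢ Finset.Icc (-q : ℤ) q).filter fun p ↦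
        c * (p.2 ^ k - p.1 ^ k) = N with hT
  rcases T.eq_empty_or_nonempty with h0 | ⟨p, hp⟩
  · rw [h0]; simp only [Finset.card_empty, Nat.cast_zero]; positivity
  have hpT := hp
  simp only [hT, Finset.mem_filter, Finset.mem_product, Finset.mem_Icc] at hp
  obtain ⟨⟨⟨a1, a2⟩, a3, a4⟩, a5⟩ := hp
  set M := p.2 ^ k - p.1 ^ k with hMdef
  have hM : M ≠ 0 := by
    intro h
    apply hN
    rw [← a5, h, mul_zero]
  have h1 := card_pow_sub_pow_eq_le hk hM T fun p' hp' ↦ by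
    have := (Finset.mem_filter.mp hp').2
    rw [← a5] at this
    exact mul_left_cancel₀ hc this
  have hb : ∀ x : ℤ, -(q : ℤ) ≤ x → x ≤ q → |x ^ k| ≤ (q : ℤ) ^ 4 := fun x h1 h2 ↦ by
    rw [abs_pow]
    exact (pow_le_pow_left₀ (abs_nonneg _) (abs_le.mpr ⟨h1, h2⟩) k).trans
      (pow_le_pow_right₀ (by exact_mod_cast hq) (by omega))
  have hMle : M.natAbs ≤ 2 * q ^ 4 := by
    zify
    have := abs_sub (p.2 ^ k) (p.1 ^ k)
    linarith [hb _ a1 a2, hb _ a3 a4]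
  have h2 := hdiv M.natAbs (Int.natAbs_ne_zero.mpr hM)
  have h3 : (M.natAbs : ℝ) ^ (ε / 4) ≤ 2 ^ (ε / 4) * (q : ℝ) ^ ε := by
    calc _ ≤ (2 * (q : ℝ) ^ 4) ^ (ε / 4) :=
          Real.rpow_le_rpow (by positivity) (by exact_mod_cast hMle) (by positivity)
      _ = _ := by
        rw [Real.mul_rpow (by positivity) (by positivity), ← Real.rpow_natCast,
          ← Real.rpow_mul (by positivity)]
        congr 2
        push_cast
        ring
  have h4 := (Nat.cast_le (α := ℝ)).mpr h1
  push_cast at h4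
  nlinarith [mul_le_mul_of_nonneg_left h3 hK.le]

end PowerDifference

section Solutions

variable {ι : Type*} [Fintype ι] [DecidableEq ι] {m : ℕ}

theorem card_pow_eq_pow_le {k : ℕ} (hk : k ≠ 0) (q : ℕ) :
    ((Finset.Icc (-q : ℤ) q ×ˢ Finset.Icc (-q : ℤ) q).filter fun p ↦
      p.2 ^ k - p.1 ^ k = 0).card ≤ 2 * (2 * q + 1) := by
  have h : ((Finset.Icc (-q : ℤ) q ×ˢ Finset.Icc (-q : ℤ) q).filter fun p ↦
      p.2 ^ k - p.1 ^ k = 0).card ≤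
      (Finset.Icc (-q : ℤ) q ×ˢ (Finset.univ : Finset Bool)).card := by
    refine Finset.card_le_card_of_injOn (fun p ↦ (p.1, decide (0 ≤ p.2))) ?_ ?_
    · intro p hp
      have := (Finset.mem_product.mp (Finset.mem_filter.mp hp).1).1
      exact Finset.mem_coe.mpr (Finset.mem_product.mpr ⟨this, Finset.mem_univ _⟩)
    · intro p hp r hr hpr
      simp only [Prod.mk.injEq, decide_eq_decide] at hpr
      obtain ⟨h1, h2⟩ := hpr
      have hp' := (Finset.mem_filter.mp hp).2
      have hr' := (Finset.mem_filter.mp hr).2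
      rw [h1] at hp'
      have h3 : |p.2| ^ k = |r.2| ^ k := by
        rw [← abs_pow, ← abs_pow, sub_eq_zero.mp hp', sub_eq_zero.mp hr']
      rw [pow_left_inj₀ (abs_nonneg _) (abs_nonneg _) hk] at h3
      refine Prod.ext h1 ?_
      rcases abs_eq_abs.mp h3 with h4 | h4 <;> omega
  rw [Finset.card_product, card_Icc_neg] at h
  simpa [mul_comm] using h

/-- The number of solutions of `c (y ^ k - x ^ k) = F(u) - F(v)` in boxes, for a non-degenerate
cubic form `F` and `k ∈ {3, 4}`. -/
theorem sq_card_solutions_le (hn : Fintype.card ι = m + 2) {t : ι → ι → ι → ℤ}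
    (h12 : ∀ i j k, t i j k = t j i k)
    (h23 : ∀ i j k, t i j k = t i k j) {i j : ι} (hij : i ≠ j) {e : ι → ℤ}
    (he : contract t e i j ^ 2 - contract t e i i * contract t e j j ≠ 0)
    {k : ℕ} (hk : k = 3 ∨ k = 4) {c : ℤ} (hc : c ≠ 0) (ε : ℝ) (hε : 0 < ε) :
    ∃ K : ℝ, 0 < K ∧ ∀ B q : ℕ, 1 ≤ q → q ≤ B →
      ((((Finset.Icc (-q : ℤ) q ×ˢ Finset.Icc (-q : ℤ) q) ×ˢ (box ι B ×ˢ box ι B)).filter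
        fun p ↦ c * (p.1.2 ^ k - p.1.1 ^ k) = cubic t p.2.1 - cubic t p.2.2).card : ℝ) ^ 2 ≤
          K * ((B : ℝ) ^ ε) ^ 2 * (q ^ 2 * B ^ (4 * m + 5)) := by
  obtain ⟨K₁, hK₁, hM⟩ := card_cubic_collisions_le hn h12 h23 hij he ε hε
  obtain ⟨K₂, hK₂, hJ⟩ := card_cubic_quadruples_le hn h12 h23 hij he ε hε
  obtain ⟨K₃, hK₃, hmul⟩ := card_mul_pow_sub_pow_eq_le hk hc ε hε
  refine ⟨2 * ((6 * K₁) ^ 2 + 9 * K₃ * K₂), by positivity, fun B q hq hqB ↦ ?_⟩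
  have hB : 1 ≤ B := hq.trans hqB
  have hBR : (1 : ℝ) ≤ B := by exact_mod_cast hB
  set I := Finset.Icc (-q : ℤ) q with hI
  set S := box ι B ×ˢ box ι B with hS
  set g : ℤ × ℤ → ℤ := fun p ↦ c * (p.2 ^ k - p.1 ^ k) with hg
  set f : (ι → ℤ) × (ι → ℤ) → ℤ := fun p ↦ cubic t p.1 - cubic t p.2 with hf
  set Z := (I ×ˢ I).filter fun p ↦ p.2 ^ k - p.1 ^ k = 0 with hZ
  set D := (I ×ˢ I).filter fun p ↦ g p ≠ 0 with hD
  have hsplit : (((I ×ˢ I) ×ˢ S).filter fun p ↦ g p.1 = f p.2).card ≤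
      ((Z ×ˢ S).filter fun p ↦ f p.2 = g p.1).card +
        ((D ×ˢ S).filter fun p ↦ g p.1 = f p.2).card := by
    rw [← Finset.card_filter_add_card_filter_not (s := ((I ×ˢ I) ×ˢ S).filter
      fun p ↦ g p.1 = f p.2) (fun p ↦ g p.1 = 0)]
    refine Nat.add_le_add (Finset.card_le_card ?_) (Finset.card_le_card ?_)
    · intro p hp
      simp only [Finset.mem_filter, Finset.mem_product, hZ] at hp ⊢
      obtain ⟨⟨⟨h1, h2⟩, h3⟩, h4⟩ := hp
      exact ⟨⟨⟨h1, (mul_eq_zero.mp h4).resolve_left hc⟩, h2⟩, h3.symm⟩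
    · intro p hp
      simp only [Finset.mem_filter, Finset.mem_product, hD] at hp ⊢
      obtain ⟨⟨⟨h1, h2⟩, h3⟩, h4⟩ := hp
      exact ⟨⟨⟨h1, h4⟩, h2⟩, h3⟩
  have hdiag : (((Z ×ˢ S).filter fun p ↦ f p.2 = g p.1).card : ℝ) ≤
      6 * q * (K₁ * (B : ℝ) ^ ε * B ^ (2 * m + 2)) := by
    rw [card_filter_product_eq_sum]
    push_cast
    have hZc := (Nat.cast_le (α := ℝ)).mpr (card_pow_eq_pow_le (k := k) (by omega) q)
    have h3 := two_mul_add_one_le hq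
    push_cast at hZc
    calc _ ≤ ∑ p ∈ Z, K₁ * (B : ℝ) ^ ε * B ^ (2 * m + 2) := Finset.sum_le_sum fun p _ ↦
            (Nat.cast_le.mpr (card_sub_eq_le _ _ _)).trans (hM B hB)
      _ = _ := by rw [Finset.sum_const, nsmul_eq_mul]
      _ ≤ _ := mul_le_mul_of_nonneg_right (by linarith) (by positivity)
  have hDD : (((D ×ˢ D).filter fun p ↦ g p.1 = g p.2).card : ℝ) ≤
      (3 * q) ^ 2 * (K₃ * (q : ℝ) ^ ε) := by
    rw [card_filter_product_eq_sum]
    push_cast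
    have hDc : (D.card : ℝ) ≤ (3 * q) ^ 2 := by
      have h1 : D.card ≤ (2 * q + 1) ^ 2 := by
        refine (Finset.card_filter_le _ _).trans ?_
        rw [Finset.card_product, card_Icc_neg, sq]
      have h2 := (Nat.cast_le (α := ℝ)).mpr h1
      push_cast at h2
      exact h2.trans (pow_le_pow_left₀ (by positivity) (two_mul_add_one_le hq) 2)
    calc _ ≤ ∑ p ∈ D, K₃ * (q : ℝ) ^ ε := Finset.sum_le_sum fun p hp ↦ by
            refine le_trans (Nat.cast_le.mpr (Finset.card_le_card ?_))
              (hmul q hq (g p) (Finset.mem_filter.mp hp).2)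
            intro r hr
            simp only [Finset.mem_filter, hD] at hr ⊢
            exact ⟨hr.1.1, hr.2.symm⟩
      _ = _ := by rw [Finset.sum_const, nsmul_eq_mul]
      _ ≤ _ := mul_le_mul_of_nonneg_right hDc (by positivity)
  have hSS : (((S ×ˢ S).filter fun p ↦ f p.1 = f p.2).card : ℝ) ≤
      K₂ * (B : ℝ) ^ ε * B ^ (4 * m + 5) := by
    refine le_trans (Nat.cast_le.mpr ?_) (hJ B hB)
    refine Finset.card_le_card_of_injOn (fun p ↦ ((p.1.1, p.2.2), (p.1.2, p.2.1))) ?_ ?_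
    · intro p hp
      simp only [hS, hf, Finset.coe_filter, Set.mem_ofPred_eq,
        Finset.mem_product] at hp ⊢
      obtain ⟨⟨⟨a1, a2⟩, a3, a4⟩, a5⟩ := hp
      exact ⟨⟨⟨a1, a4⟩, a2, a3⟩, by linarith⟩
    · intro p _ r _ hpr
      simp only [Prod.mk.injEq] at hpr
      exact Prod.ext (Prod.ext hpr.1.1 hpr.2.1) (Prod.ext hpr.2.2 hpr.1.2)
  have hoff := (Nat.cast_le (α := ℝ)).mpr (sq_card_pairs_le D S g f)
  have hsplit' := (Nat.cast_le (α := ℝ)).mpr hsplit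
  rw [Nat.cast_add] at hsplit'
  rw [Nat.cast_pow, Nat.cast_mul] at hoff
  have hqε : (q : ℝ) ^ ε ≤ (B : ℝ) ^ ε :=
    Real.rpow_le_rpow (by positivity) (by exact_mod_cast hqB) hε.le
  set a : ℝ := (((Z ×ˢ S).filter fun p ↦ f p.2 = g p.1).card : ℝ) with ha
  set b : ℝ := (((D ×ˢ S).filter fun p ↦ g p.1 = f p.2).card : ℝ) with hb
  have ha2 : a ^ 2 ≤ (6 * K₁) ^ 2 * ((B : ℝ) ^ ε) ^ 2 * (q ^ 2 * B ^ (4 * m + 5)) := by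
    calc a ^ 2 ≤ (6 * q * (K₁ * (B : ℝ) ^ ε * B ^ (2 * m + 2))) ^ 2 :=
          pow_le_pow_left₀ (by positivity) hdiag 2
      _ = (6 * K₁) ^ 2 * ((B : ℝ) ^ ε) ^ 2 * (q ^ 2 * B ^ (4 * m + 4)) := by ring
      _ ≤ _ := by
        have : (B : ℝ) ^ (4 * m + 4) ≤ B ^ (4 * m + 5) := pow_le_pow_right₀ hBR (by omega)
        gcongr
  have hb2 : b ^ 2 ≤ 9 * K₃ * K₂ * ((B : ℝ) ^ ε) ^ 2 * (q ^ 2 * B ^ (4 * m + 5)) := by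
    calc b ^ 2 ≤ _ := hoff
      _ ≤ ((3 * q) ^ 2 * (K₃ * (q : ℝ) ^ ε)) * (K₂ * (B : ℝ) ^ ε * B ^ (4 * m + 5)) :=
          mul_le_mul hDD hSS (by positivity) (by positivity)
      _ ≤ ((3 * q) ^ 2 * (K₃ * (B : ℝ) ^ ε)) * (K₂ * (B : ℝ) ^ ε * B ^ (4 * m + 5)) := by
          gcongr
      _ = _ := by ring
  calc _ ≤ (a + b) ^ 2 := pow_le_pow_left₀ (by positivity) hsplit' 2
    _ ≤ 2 * (a ^ 2 + b ^ 2) := by nlinarith [sq_nonneg (a - b)]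
    _ ≤ _ := by nlinarith

end Solutions

section CubicForm

variable {ι : Type*}

theorem pderiv_pderiv_comm {R : Type*} [CommRing R] (i j : ι) (p : MvPolynomial ι R) :
    MvPolynomial.pderiv i (MvPolynomial.pderiv j p) =
      MvPolynomial.pderiv j (MvPolynomial.pderiv i p) := by
  classical
  have h : ⁅(MvPolynomial.pderiv i : Derivation R (MvPolynomial ι R) (MvPolynomial ι R)),
      (MvPolynomial.pderiv j : Derivation R (MvPolynomial ι R) (MvPolynomial ι R))⁆ = 0 := by
    refine MvPolynomial.derivation_ext fun l ↦ ?_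
    rw [Derivation.commutator_apply, MvPolynomial.pderiv_X, MvPolynomial.pderiv_X]
    by_cases h1 : i = l <;> by_cases h2 : j = l <;> simp [h1, h2, eq_comm]
  have h' := congrArg (fun D ↦ D p) h
  simpa [Derivation.commutator_apply, sub_eq_zero] using h'

/-- The third derivatives at the origin. -/
noncomputable def thirdDeriv (p : MvPolynomial ι ℤ) (i j k : ι) : ℤ :=
  MvPolynomial.constantCoeff
    (MvPolynomial.pderiv k (MvPolynomial.pderiv j (MvPolynomial.pderiv i p)))

theorem thirdDeriv_swap_left (p : MvPolynomial ι ℤ) (i j k : ι) :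
    thirdDeriv p i j k = thirdDeriv p j i k := by
  rw [thirdDeriv, thirdDeriv, pderiv_pderiv_comm j i]

theorem thirdDeriv_swap_right (p : MvPolynomial ι ℤ) (i j k : ι) :
    thirdDeriv p i j k = thirdDeriv p i k j := by
  rw [thirdDeriv, thirdDeriv, pderiv_pderiv_comm k j]

variable [Fintype ι]

theorem six_mul_eq_sum_thirdDeriv {p : MvPolynomial ι ℤ} (hp : p.IsHomogeneous 3) :
    6 * p = ∑ i, ∑ j, ∑ k, MvPolynomial.C (thirdDeriv p i j k) * MvPolynomial.X k *
      MvPolynomial.X i * MvPolynomial.X j := by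
  have h0 : ∀ i j k, MvPolynomial.pderiv k (MvPolynomial.pderiv j (MvPolynomial.pderiv i p)) =
      MvPolynomial.C (thirdDeriv p i j k) := fun i j k ↦ by
    have h := (hp.pderiv (i := i)).pderiv (i := j) |>.pderiv (i := k)
    rw [← MvPolynomial.totalDegree_zero_iff_isHomogeneous,
      MvPolynomial.totalDegree_eq_zero_iff_eq_C] at h
    exact h
  have h1 : ∀ i j, ∑ k, MvPolynomial.X k * MvPolynomial.C (thirdDeriv p i j k) =
      MvPolynomial.pderiv j (MvPolynomial.pderiv i p) := fun i j ↦ by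
    have := (hp.pderiv (i := i)).pderiv (i := j) |>.sum_X_mul_pderiv
    simpa [h0] using this
  have h2 : ∀ i, ∑ j, MvPolynomial.X j * MvPolynomial.pderiv j (MvPolynomial.pderiv i p) =
      2 * MvPolynomial.pderiv i p := fun i ↦ by
    simpa using (hp.pderiv (i := i)).sum_X_mul_pderiv
  have h3 : ∑ i, MvPolynomial.X i * MvPolynomial.pderiv i p = 3 * p := by
    simpa using hp.sum_X_mul_pderiv
  calc 6 * p = 2 * (3 * p) := by ring
    _ = ∑ i, MvPolynomial.X i * ∑ j, MvPolynomial.X j *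
        ∑ k, MvPolynomial.X k * MvPolynomial.C (thirdDeriv p i j k) := by
      simp only [h1, h2, ← h3, Finset.mul_sum]
      exact Finset.sum_congr rfl fun i _ ↦ by ring
    _ = _ := by
      simp only [Finset.mul_sum]
      exact Finset.sum_congr rfl fun i _ ↦ Finset.sum_congr rfl fun j _ ↦
        Finset.sum_congr rfl fun k _ ↦ by ring

theorem six_mul_eval_eq_cubic {p : MvPolynomial ι ℤ} (hp : p.IsHomogeneous 3) (x : ι → ℤ) :
    6 * MvPolynomial.eval x p = cubic (thirdDeriv p) x := by
  have h := congrArg (MvPolynomial.eval x) (six_mul_eq_sum_thirdDeriv hp)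
  simpa [cubic, quad, contract, Finset.sum_mul] using h

theorem eq_mul_cube_of_thirdDeriv {p : MvPolynomial ι ℤ} (hp : p.IsHomogeneous 3)
    {a : ℚ} {b : ι → ℚ} (h : ∀ i j k, (thirdDeriv p i j k : ℚ) = a * b i * b j * b k) :
    MvPolynomial.map (Int.castRingHom ℚ) p =
      MvPolynomial.C (a / 6) * (∑ i, MvPolynomial.C (b i) * MvPolynomial.X i) ^ 3 := by
  have h1 := congrArg (MvPolynomial.map (Int.castRingHom ℚ)) (six_mul_eq_sum_thirdDeriv hp)
  simp only [map_mul, map_sum, MvPolynomial.map_C, MvPolynomial.map_X, map_ofNat,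
    eq_intCast (Int.castRingHom ℚ), h] at h1
  have h6 : (MvPolynomial.C (1 / 6) : MvPolynomial ι ℚ) * 6 = 1 := by
    rw [show (6 : MvPolynomial ι ℚ) = MvPolynomial.C 6 from (map_ofNat _ 6).symm, ← map_mul]
    norm_num
  calc _ = MvPolynomial.C (1 / 6) * (6 * MvPolynomial.map (Int.castRingHom ℚ) p) := by
        rw [← mul_assoc, h6, one_mul]
    _ = _ := by
      rw [h1, pow_three, Finset.sum_mul_sum, Finset.sum_mul_sum, div_eq_mul_one_div a,
        mul_comm a, map_mul, mul_assoc]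
      congr 1
      simp only [Finset.mul_sum]
      exact Finset.sum_congr rfl fun i _ ↦ Finset.sum_congr rfl fun j _ ↦
        Finset.sum_congr rfl fun k _ ↦ by ring

end CubicForm

theorem abs_le_natFloor {x : ℤ} {P : ℝ} (h : |(x : ℝ)| ≤ P) : |x| ≤ (⌊P⌋₊ : ℤ) := by
  have : x.natAbs ≤ ⌊P⌋₊ := Nat.le_floor (by rw [Nat.cast_natAbs, Int.cast_abs]; exact h)
  rw [Int.abs_eq_natAbs]
  exact_mod_cast this

theorem le_of_sq_le_of_floor {m : ℕ} {K ε P Q N : ℝ} {B q : ℕ} (hK : 0 ≤ K) (hε : 0 ≤ ε)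
    (hP : 0 < P) (hQ : 0 ≤ Q) (hQP : Q ≤ P) (hB : (B : ℝ) ≤ P) (hq : (q : ℝ) ≤ Q)
    (h : N ^ 2 ≤ K * ((B : ℝ) ^ ε) ^ 2 * (q ^ 2 * B ^ (4 * m + 5))) :
    N ≤ √K * P ^ ((2 * m + 3 : ℕ) + ε) * Q ^ ((1 : ℝ) / 2) := by
  have hBε : (B : ℝ) ^ ε ≤ P ^ ε := Real.rpow_le_rpow (by positivity) hB hε
  have hq2 : (q : ℝ) ^ 2 ≤ Q * P := by
    rw [sq]
    exact mul_le_mul hq (hq.trans hQP) (by positivity) hQ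
  refine le_of_abs_le (abs_le_of_sq_le_sq (h.trans ?_) (by positivity))
  calc K * ((B : ℝ) ^ ε) ^ 2 * (q ^ 2 * B ^ (4 * m + 5))
      ≤ K * (P ^ ε) ^ 2 * ((Q * P) * P ^ (4 * m + 5)) := by gcongr
    _ = √K ^ 2 * (P ^ (2 * m + 3) * P ^ ε) ^ 2 * √Q ^ 2 := by
      rw [Real.sq_sqrt hK, Real.sq_sqrt hQ]; ring
    _ = _ := by
      rw [Real.rpow_add hP, Real.rpow_natCast, ← Real.sqrt_eq_rpow]; ring

open MvPolynomial

/-- **Squarefree density of polynomials, Corollary 2.**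
For `s ≥ 3`, `k ∈ {3,4}`, `c ≠ 0` and a non-degenerate integral cubic form `𝒞*` in
`s-1` variables, the number `L(P)` of solutions of
`c x₁^k + 𝒞*(x₂,…,x_s) = c X₁^k + 𝒞*(X₂,…,X_s)` with `|x₁|, |X₁| ≤ Q = P^(3/k)` and
`|x_j|, |X_j| ≤ P` satisfies `L(P) ≪ P^(2s-3+ε) Q^(1/2)`. -/
theorem squarefree_density_cor2 (s : ℕ) (hs : 3 ≤ s) (k : ℕ) (hk : k = 3 ∨ k = 4)
    (c : ℤ) (hc : c ≠ 0)
    (𝒞 : MvPolynomial (Fin (s - 1)) ℤ) (hhom : 𝒞.IsHomogeneous 3)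
    (hdeg : ¬ ∃ (a : ℚ) (b : Fin (s - 1) → ℚ),
      MvPolynomial.map (Int.castRingHom ℚ) 𝒞 =
        MvPolynomial.C a * (∑ i, MvPolynomial.C (b i) * MvPolynomial.X i) ^ 3)
    (ε : ℝ) (hε : 0 < ε) :
    ∃ K : ℝ, ∀ P : ℝ, 2 ≤ P →
      (Nat.card {v : (ℤ × (Fin (s - 1) → ℤ)) × (ℤ × (Fin (s - 1) → ℤ)) //
          (|v.1.1| : ℝ) ≤ P ^ ((3 : ℝ) / k) ∧ (|v.2.1| : ℝ) ≤ P ^ ((3 : ℝ) / k) ∧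
          (∀ j, (|v.1.2 j| : ℝ) ≤ P) ∧ (∀ j, (|v.2.2 j| : ℝ) ≤ P) ∧
          c * v.1.1 ^ k + eval v.1.2 𝒞 = c * v.2.1 ^ k + eval v.2.2 𝒞} : ℝ)
        ≤ K * P ^ (2 * (s : ℝ) - 3 + ε) * (P ^ ((3 : ℝ) / k)) ^ ((1 : ℝ) / 2) := by
  obtain ⟨m, rfl⟩ : ∃ m, s = m + 3 := ⟨s - 3, by omega⟩
  have hn : Fintype.card (Fin (m + 3 - 1)) = m + 2 := by simp
  obtain ⟨i, j, hij, e, he⟩ : ∃ i j, i ≠ j ∧ ∃ e, contract (thirdDeriv 𝒞) e i j ^ 2 -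
      contract (thirdDeriv 𝒞) e i i * contract (thirdDeriv 𝒞) e j j ≠ 0 := by
    by_contra! H
    obtain ⟨a, b, hab⟩ := eq_mul_cube_of_minors (thirdDeriv_swap_left 𝒞)
      (thirdDeriv_swap_right 𝒞) H
    exact hdeg ⟨_, _, eq_mul_cube_of_thirdDeriv hhom hab⟩
  obtain ⟨K, hK, hcount⟩ := sq_card_solutions_le hn (thirdDeriv_swap_left 𝒞)
    (thirdDeriv_swap_right 𝒞) hij he hk (mul_ne_zero (by norm_num : (6 : ℤ) ≠ 0) hc) ε hε
  refine ⟨√K, fun P hP ↦ ?_⟩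
  have hP1 : 1 ≤ P := by linarith
  have hk3 : (3 : ℝ) ≤ k := by rcases hk with rfl | rfl <;> norm_num
  set Q := P ^ ((3 : ℝ) / k) with hQ
  have hQ1 : 1 ≤ Q := Real.one_le_rpow hP1 (by positivity)
  have hQP : Q ≤ P := by
    calc Q ≤ P ^ (1 : ℝ) := Real.rpow_le_rpow_of_exponent_le hP1
          ((div_le_one (by linarith)).mpr hk3)
      _ = P := Real.rpow_one P
  have hq1 : 1 ≤ ⌊Q⌋₊ := Nat.le_floor (by exact_mod_cast hQ1)
  have hfin := le_of_sq_le_of_floor hK.le hε.le (by linarith) (by linarith) hQP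
    (Nat.floor_le (by linarith)) (Nat.floor_le (by linarith))
    (hcount ⌊P⌋₊ ⌊Q⌋₊ hq1 (Nat.floor_le_floor hQP))
  rw [show (2 * ((m + 3 : ℕ) : ℝ) - 3 + ε) = (2 * m + 3 : ℕ) + ε by push_cast; ring]
  refine le_trans (Nat.cast_le.mpr ?_) hfin
  rw [← Fintype.card_coe, ← Nat.card_eq_fintype_card]
  refine Nat.card_le_card_of_injective (fun v ↦ ⟨((v.1.1.1, v.1.2.1), (v.1.1.2, v.1.2.2)), ?_⟩) ?_
  · obtain ⟨v, h1, h2, h3, h4, h5⟩ := v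
    simp only [Finset.mem_filter, Finset.mem_product, mem_box, Finset.mem_Icc, ← abs_le,
      ← six_mul_eval_eq_cubic hhom]
    refine ⟨⟨⟨abs_le_natFloor h1, abs_le_natFloor h2⟩, fun j ↦ abs_le_natFloor (h3 j),
      fun j ↦ abs_le_natFloor (h4 j)⟩, by linarith⟩
  · intro v w hvw
    simp only [Subtype.mk.injEq, Prod.mk.injEq] at hvw
    exact Subtype.ext (Prod.ext (Prod.ext hvw.1.1 hvw.2.1) (Prod.ext hvw.1.2 hvw.2.2))
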